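/- arXiv:math/0307248 — 2 statements merged into one kernel-verified Lean document; each statement's English description precedes it below -/
import Mathlib

section
/- Suppose the grading is S-regular and locally free. Then it is N-regular; that is, if g_1 contains a regular semisimple element of g and there exists y ∈ g_1 with z(y) ∩ g_0 = 0, then g_1 contains a regular nilpotent element of g. -/
open LieAlgebra Module

variable (k : Type*) [Field k] [IsAlgClosed k] [CharZero k]
variable (g : Type*) [LieRing g] [LieAlgebra k g] [FiniteDimensional k g]
  [LieAlgebra.IsSemisimple k g]

/-- The `ζ^i`-eigenspace of the automorphism `θ`, i.e. the graded piece `g_i`. -/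
noncomputable def gradePiece {m : ℕ} (ζ : k) (θ : g ≃ₗ[k] g) (i : ZMod m) : Submodule k g :=
  Module.End.eigenspace (θ : g →ₗ[k] g) (ζ ^ i.val)

/-- The centraliser `z(x) = {y : ⁅x, y⁆ = 0}` of `x`. -/
noncomputable def zc (x : g) : Submodule k g := LinearMap.ker (LieAlgebra.ad k g x)

/-- Truncated exponential of an endomorphism; it agrees with the exponential series for
nilpotent endomorphisms of a finite-dimensional space. -/
noncomputable def expEnd (N : Module.End k g) : Module.End k g :=
  ∑ i ∈ Finset.range (Module.finrank k g + 1), ((i.factorial : k))⁻¹ • N ^ i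

/-- The group `Int g` of inner automorphisms: the subgroup of the automorphism group
generated by `exp (ad n)` for `n` with `ad n` nilpotent. -/
noncomputable def IntG : Subgroup (g ≃ₗ[k] g) :=
  Subgroup.closure {τ | ∃ n : g, IsNilpotent (LieAlgebra.ad k g n) ∧
    (τ : g →ₗ[k] g) = expEnd k g (LieAlgebra.ad k g n)}

/-- A Cartan subspace of `g_1`: a commutative subspace consisting of semisimple elements,
maximal among subspaces of `g_1` with these two properties. -/
def IsCartanSubspace (m : ℕ) (ζ : k) (θ : g ≃ₗ[k] g) (c : Submodule k g) : Prop :=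
  c ≤ gradePiece k g ζ θ (1 : ZMod m) ∧
  (∀ x ∈ c, ∀ y ∈ c, ⁅x, y⁆ = 0) ∧
  (∀ x ∈ c, (LieAlgebra.ad k g x).IsSemisimple) ∧
  ∀ c' : Submodule k g, c' ≤ gradePiece k g ζ θ (1 : ZMod m) →
    (∀ x ∈ c', ∀ y ∈ c', ⁅x, y⁆ = 0) → (∀ x ∈ c', (LieAlgebra.ad k g x).IsSemisimple) →
    c ≤ c' → c = c'

/-- Polynomial functions on `g`: functions arising from the symmetric algebra of `g*`. -/
def IsPolyFun (F : g → k) : Prop :=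
  ∃ p : MvPolynomial (Module.Dual k g) k, ∀ x, F x = MvPolynomial.eval (fun φ => φ x) p

/-- The number `k_i = Σ_{c ∈ ℤ, c ≡ i (mod m)} dim {v ∈ z(e) : ⁅h, v⁆ = 2c • v}`. -/
noncomputable def kNum (m : ℕ) (e h : g) (i : ZMod m) : ℕ :=
  ∑ᶠ c : ℤ, if ((c : ZMod m) = i) then
    Module.finrank k ↥(zc k g e ⊓ Module.End.eigenspace (LieAlgebra.ad k g h) (2 * (c : k)))
  else 0

section PNR
set_option linter.unusedSectionVars false
variable {k : Type*} [Field k] [CharZero k]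
variable {g : Type*} [LieRing g] [LieAlgebra k g]

/-- The sum of the pieces with index in `P`. -/
def PNR.part {I : Type*} (A : I → Submodule k g) (P : Set I) : Submodule k g := ⨆ i ∈ P, A i

namespace PNR

section part
variable {I : Type*} {A : I → Submodule k g}

lemma le_part {P : Set I} {i : I} (hi : i ∈ P) : A i ≤ part A P :=
  le_biSup A hi

lemma mem_part {P : Set I} {i : I} (hi : i ∈ P) {v : g} (hv : v ∈ A i) : v ∈ part A P :=
  le_part hi hv

lemma part_le {P : Set I} {B : Submodule k g} (h : ∀ i ∈ P, A i ≤ B) : part A P ≤ B :=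
  iSup₂_le h

lemma part_mono {P Q : Set I} (h : P ⊆ Q) : part A P ≤ part A Q :=
  part_le fun _ hi => le_part (h hi)

lemma part_singleton (i : I) : part A {i} = A i := by simp [part]

lemma part_univ : part A Set.univ = ⨆ i, A i := by simp [part]

lemma part_union (P Q : Set I) : part A (P ∪ Q) = part A P ⊔ part A Q := by
  simp only [part, Set.mem_union, iSup_or, iSup_sup_eq]

lemma split {P Q R : Set I} (h : P ⊆ Q ∪ R) {v : g} (hv : v ∈ part A P) :
    ∃ a ∈ part A Q, ∃ b ∈ part A R, v = a + b := by
  have := part_mono (A := A) h hv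
  rw [part_union, Submodule.mem_sup] at this
  obtain ⟨a, ha, b, hb, e⟩ := this
  exact ⟨a, ha, b, hb, e.symm⟩

lemma part_disj (hA : iSupIndep A) {P Q : Set I} (h : Disjoint P Q) {v : g}
    (h1 : v ∈ part A P) (h2 : v ∈ part A Q) : v = 0 := by
  have := hA.disjoint_biSup_biSup h
  exact (Submodule.disjoint_def.mp this) v h1 h2

end part

/-- A Lie algebra grading by the integers. -/
structure LieGr (A : ℤ → Submodule k g) : Prop where
  top : ⨆ i, A i = ⊤
  ind : iSupIndep A
  lie : ∀ i j u v, u ∈ A i → v ∈ A j → ⁅u, v⁆ ∈ A (i + j)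

abbrev up (A : ℤ → Submodule k g) (j : ℤ) : Submodule k g := part A (Set.Ici j)
abbrev dn (A : ℤ → Submodule k g) (j : ℤ) : Submodule k g := part A (Set.Iic j)

variable {A : ℤ → Submodule k g}

lemma LieGr.lie_part (hA : LieGr A) {P Q R : Set ℤ} (h : ∀ i ∈ P, ∀ j ∈ Q, i + j ∈ R)
    {u v : g} (hu : u ∈ part A P) (hv : v ∈ part A Q) : ⁅u, v⁆ ∈ part A R := by
  have h1 : ∀ i ∈ P, ∀ u ∈ A i, ⁅u, v⁆ ∈ part A R := by
    intro i hi u hu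
    have : part A Q ≤ (part A R).comap (LieAlgebra.ad k g u : g →ₗ[k] g) :=
      part_le fun j hj w hw => mem_part (h i hi j hj) (hA.lie i j u w hu hw)
    exact this hv
  have : part A P ≤ (part A R).comap (-(LieAlgebra.ad k g v : g →ₗ[k] g)) :=
    part_le fun i hi w hw => by
      have := h1 i hi w hw
      rw [Submodule.mem_comap, LinearMap.neg_apply, LieAlgebra.ad_apply, lie_skew]
      exact this
  have := this hu
  rwa [Submodule.mem_comap, LinearMap.neg_apply, LieAlgebra.ad_apply, lie_skew] at this

lemma LieGr.mem_univ (hA : LieGr A) (v : g) : v ∈ part A Set.univ := by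
  rw [part_univ, hA.top]; trivial

lemma LieGr.neg (hA : LieGr A) : LieGr (fun i => A (-i)) where
  top := by rw [← hA.top]; exact (Equiv.neg ℤ).iSup_comp (g := A)
  ind := hA.ind.comp neg_injective
  lie i j u v hu hv := by rw [neg_add]; exact hA.lie _ _ _ _ hu hv

lemma up_neg (j : ℤ) : up (fun i => A (-i)) j = dn A (-j) := by
  apply le_antisymm
  · exact part_le fun i hi => le_part (A := A) (by simpa using hi)
  · refine part_le fun i hi => ?_
    have : A i = (fun i => A (-i)) (-i) := by simp
    rw [this]
    exact le_part (A := fun i => A (-i)) (by simp at hi ⊢; omega)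

lemma LieGr.exists_bound [FiniteDimensional k g] (hA : LieGr A) :
    ∃ N : ℕ, ∀ i : ℤ, (N : ℤ) < |i| → A i = ⊥ := by
  have hf : {i | A i ≠ ⊥}.Finite := WellFoundedGT.finite_ne_bot_of_iSupIndep hA.ind
  obtain ⟨N, hN⟩ := (hf.image (fun i => i.natAbs)).bddAbove
  refine ⟨N, fun i hi => ?_⟩
  by_contra h
  have := hN ⟨i, h, rfl⟩
  rw [Int.abs_eq_natAbs] at hi
  simp at this
  omega

lemma LieGr.up_top [FiniteDimensional k g] (hA : LieGr A) {N : ℕ}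
    (hN : ∀ i : ℤ, (N : ℤ) < |i| → A i = ⊥) : up A (-N) = ⊤ := by
  rw [eq_top_iff, ← hA.top]
  refine iSup_le fun i => ?_
  by_cases h : -(N : ℤ) ≤ i
  · exact le_part h
  · rw [hN i (by rw [lt_abs]; omega)]; exact bot_le

lemma LieGr.up_bot {N : ℕ}
    (hN : ∀ i : ℤ, (N : ℤ) < |i| → A i = ⊥) : up A (N + 1) = ⊥ := by
  rw [eq_bot_iff]
  refine part_le fun i hi => ?_
  rw [hN i (by rw [lt_abs]; simp at hi; omega)]

lemma LieGr.pow_up (hA : LieGr A) {z : g} {j : ℤ} (hz : z ∈ up A j) (n : ℕ) {i : ℤ} {v : g}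
    (hv : v ∈ up A i) : ((LieAlgebra.ad k g z) ^ n) v ∈ up A (i + n * j) := by
  induction n with
  | zero => simpa using hv
  | succ n ih =>
    rw [pow_succ']
    exact hA.lie_part (by intro a ha b hb; simp at ha hb ⊢; nlinarith) hz ih

lemma LieGr.nilp [FiniteDimensional k g] (hA : LieGr A) {z : g} (hz : z ∈ up A 1) :
    IsNilpotent (LieAlgebra.ad k g z) := by
  obtain ⟨N, hN⟩ := hA.exists_bound
  refine ⟨2 * N + 1, ?_⟩
  ext v
  have := hA.pow_up hz (2 * N + 1) (v := v) (i := -N) (by rw [hA.up_top hN]; trivial)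
  have e : (-(N : ℤ) + ((2 * N + 1 : ℕ) : ℤ) * 1) = N + 1 := by push_cast; ring
  rw [e, LieGr.up_bot hN] at this
  simpa using this

/-- Lie algebra automorphisms as a subgroup of the linear automorphisms. -/
def Au (k g : Type*) [Field k] [LieRing g] [LieAlgebra k g] : Subgroup (g ≃ₗ[k] g) where
  carrier := {s | ∀ x y, s ⁅x, y⁆ = ⁅s x, s y⁆}
  one_mem' := by intro x y; rfl
  mul_mem' := by
    intro a b ha hb x y
    simp only [LinearEquiv.mul_apply]
    rw [hb, ha]
  inv_mem' := by
    intro a ha x y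
    apply a.injective
    rw [ha]
    simp only [← LinearEquiv.mul_apply, mul_inv_cancel]
    rfl

/-- Unipotent automorphisms for the grading. -/
def Un (A : ℤ → Submodule k g) [FiniteDimensional k g] : Subgroup (g ≃ₗ[k] g) where
  carrier := {s | s ∈ Au k g ∧ ∀ j, ∀ v ∈ up A j, s v - v ∈ up A (j + 1)}
  one_mem' := ⟨one_mem _, fun j v hv => by simp⟩
  mul_mem' := by
    rintro a b ⟨ha, ha'⟩ ⟨hb, hb'⟩
    refine ⟨mul_mem ha hb, fun j v hv => ?_⟩
    have h1 := hb' j v hv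
    have h2 : b v ∈ up A j := by
      have : b v = (b v - v) + v := by abel
      rw [this]
      exact add_mem (part_mono (by intro i hi; simp at hi ⊢; omega) h1) hv
    have := add_mem (ha' j _ h2) h1
    simpa using this
  inv_mem' := by
    rintro a ⟨ha, ha'⟩
    refine ⟨inv_mem ha, fun j v hv => ?_⟩
    have hle : (up A j).map (a : g →ₗ[k] g) ≤ up A j := by
      rintro _ ⟨w, hw, rfl⟩
      have : a w = (a w - w) + w := by abel
      change a w ∈ _
      rw [this]
      exact add_mem (part_mono (by intro i hi; simp at hi ⊢; omega) (ha' j w hw)) hw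
    have heq : (up A j).map (a : g →ₗ[k] g) = up A j := by
      apply Submodule.eq_of_le_of_finrank_eq hle
      exact LinearEquiv.finrank_map_eq a _
    rw [← heq] at hv
    obtain ⟨w, hw, rfl⟩ := hv
    have : a⁻¹ (a w) = w := by rw [← LinearEquiv.mul_apply]; simp
    change a⁻¹ (a w) - a w ∈ _
    rw [this, ← neg_sub]
    exact neg_mem (ha' j w hw)

lemma Un.map_up [FiniteDimensional k g] {s : g ≃ₗ[k] g} (hs : s ∈ Un A) {j : ℤ} {v : g}
    (hv : v ∈ up A j) : s v ∈ up A j := by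
  have : s v = (s v - v) + v := by abel
  rw [this]
  exact add_mem (part_mono (by intro i hi; simp at hi ⊢; omega) (hs.2 j v hv)) hv

lemma exists_exp [FiniteDimensional k g] (hA : LieGr A) {z : g} {j : ℤ} (hj : 1 ≤ j)
    (hz : z ∈ up A j) :
    ∃ s ∈ Un A, ∀ i, ∀ v ∈ up A i, s v - v - ⁅z, v⁆ ∈ up A (i + 2 * j) := by
  let _i : Module ℚ g := Module.compHom g (algebraMap ℚ k)
  have hls : ∀ (q : ℚ) (x y : g), ⁅x, q • y⁆ = q • ⁅x, y⁆ := by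
    intro q x y
    change ⁅x, (algebraMap ℚ k q) • y⁆ = (algebraMap ℚ k q) • ⁅x, y⁆
    simp only [lie_smul]
  let _i : LieAlgebra ℚ g := { lie_smul := hls }
  have hz1 : z ∈ up A 1 := part_mono (by intro i hi; simp at hi ⊢; omega) hz
  have hD : (LieDerivation.ad k g z).toLinearMap = LieAlgebra.ad k g z := by
    ext v
    change LieDerivation.ad k g z v = _
    simp
  have hn : IsNilpotent (LieDerivation.ad k g z).toLinearMap := by
    have := hA.nilp hz1
    rwa [hD]
  let s := LieDerivation.exp (LieDerivation.ad k g z) hn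
  have key : ∀ i, ∀ v ∈ up A i, s v - v - ⁅z, v⁆ ∈ up A (i + 2 * j) := by
    intro i v hv
    have hn2 := hn
    obtain ⟨n, hn'⟩ := hn2
    have h0 : ((LieDerivation.ad k g z).toLinearMap) ^ (n + 2) = 0 := by
      rw [pow_add, hn', zero_mul]
    have : s v = ∑ i ∈ Finset.range (n + 2), (algebraMap ℚ k (i.factorial : ℚ)⁻¹) •
        ((LieAlgebra.ad k g z ^ i) v) := by
      change LieDerivation.exp (LieDerivation.ad k g z) hn v = _
      rw [LieDerivation.exp_map_apply, IsNilpotent.exp_eq_sum h0, hD]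
      simp only [LinearMap.sum_apply]
      rfl
    rw [this, Finset.sum_range_succ', Finset.sum_range_succ']
    simp only [zero_add, Nat.factorial_one, Nat.cast_one, inv_one, map_one, pow_one, one_smul,
      Nat.factorial_zero, pow_zero, Module.End.one_apply, LieAlgebra.ad_apply, add_sub_cancel_right]
    refine sum_mem fun a _ => Submodule.smul_mem _ _ ?_
    refine part_mono ?_ (hA.pow_up hz (a + 1 + 1) hv)
    intro b hb
    simp at hb ⊢
    nlinarith
  refine ⟨s.toLinearEquiv, ⟨fun x y => s.map_lie x y, fun i v hv => ?_⟩, key⟩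
  have h1 := key i v hv
  have h2 : ⁅z, v⁆ ∈ up A (i + 1) :=
    hA.lie_part (by intro a ha b hb; simp at ha hb ⊢; omega) hz1 hv
  have h3 : s v - v = (s v - v - ⁅z, v⁆) + ⁅z, v⁆ := by abel
  change s v - v ∈ _
  rw [h3]
  exact add_mem (part_mono (by intro b hb; simp at hb ⊢; omega) h1) h2

lemma exists_conj [FiniteDimensional k g] (hA : LieGr A) {y : g}
    (hy0 : y ∈ A 0)
    (hy : ∀ j, 1 ≤ j → ∀ r ∈ A j, ∃ z ∈ A j, ⁅y, z⁆ = r) {n : g} (hn : n ∈ up A 1) :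
    ∃ s ∈ Un A, s y = y + n := by
  have step : ∀ j : ℕ, ∃ s ∈ Un A, y + n - s y ∈ up A (j + 1) := by
    intro j
    induction j with
    | zero => exact ⟨1, one_mem _, by simpa using hn⟩
    | succ j ih =>
      obtain ⟨s, hs, h⟩ := ih
      obtain ⟨r, hr, r', hr', e⟩ := split (Q := {(j : ℤ) + 1}) (R := Set.Ici ((j : ℤ) + 1 + 1))
        (by intro i hi; simp at hi ⊢; omega) h
      rw [part_singleton] at hr
      obtain ⟨z, hz, hzr⟩ := hy _ (by omega) r hr
      have hz' : -z ∈ up A (j + 1) := neg_mem (mem_part (by simp) hz)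
      obtain ⟨s', hs', key⟩ := exists_exp hA (by omega) hz'
      refine ⟨s' * s, mul_mem hs' hs, ?_⟩
      have hy' : y ∈ up A 0 := mem_part (by simp) hy0
      have h1 := hs.2 0 y hy'
      have h2 := key 0 (s y) (Un.map_up hs hy')
      have h3 : ⁅z, s y - y⁆ ∈ up A (j + 1 + 1) :=
        hA.lie_part (by intro a ha b hb; simp at ha hb ⊢; omega) (neg_mem_iff.mp hz') h1
      have : y + n - (s' * s) y = r' - (s' (s y) - s y - ⁅-z, s y⁆) + ⁅z, s y - y⁆ := by
        have e1 : y + n = s y + (r + r') := by rw [← e]; abel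
        rw [LinearEquiv.mul_apply, e1, ← hzr, ← lie_skew y z]
        simp only [neg_lie, lie_sub]
        abel
      rw [this]
      push_cast
      refine add_mem (sub_mem hr' (part_mono ?_ h2)) h3
      intro i hi; simp at hi ⊢; omega
  obtain ⟨N, hN⟩ := hA.exists_bound
  obtain ⟨s, hs, h⟩ := step N
  rw [LieGr.up_bot hN] at h
  refine ⟨s, hs, ?_⟩
  rw [Submodule.mem_bot, sub_eq_zero] at h
  exact h.symm

end PNR
end PNR

section PNR
set_option linter.unusedSectionVars false
variable {k : Type*} [Field k] [CharZero k]
variable {g : Type*} [LieRing g] [LieAlgebra k g] [FiniteDimensional k g]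

namespace PNR
variable {ι : Type*} [Fintype ι] [DecidableEq ι]

/-- joint weight space for integral weights -/
def wt (k : Type*) [Field k] {g : Type*} [LieRing g] [LieAlgebra k g] {ι : Type*}
    (ω : ι → g) (μ : ι → ℤ) : Submodule k g :=
  ⨅ i, Module.End.eigenspace (LieAlgebra.ad k g (ω i)) (μ i : k)

lemma mem_wt {ω : ι → g} {μ : ι → ℤ} {v : g} :
    v ∈ wt k ω μ ↔ ∀ i, ⁅ω i, v⁆ = (μ i : k) • v := by
  simp [wt, Submodule.mem_iInf]

/-- the principal grading -/
def gr (k : Type*) [Field k] {g : Type*} [LieRing g] [LieAlgebra k g]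
    (h : g) (j : ℤ) : Submodule k g :=
  Module.End.eigenspace (LieAlgebra.ad k g h) (j : k)

lemma mem_gr {h : g} {j : ℤ} {v : g} : v ∈ gr k h j ↔ ⁅h, v⁆ = (j : k) • v := by
  simp [gr]

/-- pinned frame -/
structure PF (k : Type*) [Field k] {g : Type*} [LieRing g] [LieAlgebra k g]
    {ι : Type*} [Fintype ι] [DecidableEq ι] (x : g) (ω E : ι → g) (F : g) : Prop where
  comm : ∀ i j, ⁅ω i, ω j⁆ = 0
  top : ⨆ μ : ι → ℤ, wt k ω μ = ⊤
  sgn : ∀ μ, wt k ω μ ≠ ⊥ → 0 ≤ μ ∨ μ ≤ 0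
  zx : ∀ v, v ∈ wt k ω 0 ↔ ⁅x, v⁆ = 0
  span : wt k ω 0 ≤ Submodule.span k (Set.range ω)
  line : ∀ μ, μ ≠ 0 → finrank k (wt k ω μ) ≤ 1
  E_mem : ∀ i, E i ∈ wt k ω (Pi.single i 1)
  E_ne : ∀ i, E i ≠ 0
  F_mem : ⁅∑ i, ω i, F⁆ = -F
  sl2 : ⁅∑ i, E i, F⁆ = (2 : k) • ∑ i, ω i

lemma wt_lie {ω : ι → g} {μ ν : ι → ℤ} {u v : g} (hu : u ∈ wt k ω μ) (hv : v ∈ wt k ω ν) :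
    ⁅u, v⁆ ∈ wt k ω (μ + ν) := by
  rw [mem_wt] at *
  intro i
  rw [leibniz_lie, hu, hv]
  simp [add_smul]

lemma gr_lie {h : g} {i j : ℤ} {u v : g} (hu : u ∈ gr k h i) (hv : v ∈ gr k h j) :
    ⁅u, v⁆ ∈ gr k h (i + j) := by
  rw [mem_gr] at *
  rw [leibniz_lie, hu, hv]
  simp [add_smul]

lemma gr_ind (h : g) : iSupIndep (gr k h) :=
  (Module.End.eigenspaces_iSupIndep (LieAlgebra.ad k g h)).comp (f := fun j : ℤ => (j : k))
    Int.cast_injective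

namespace PF
variable {x : g} {ω E : ι → g} {F : g}

lemma wt_le (ω : ι → g) (μ : ι → ℤ) : wt k ω μ ≤ gr k (∑ i, ω i) (∑ i, μ i) := by
  intro v hv
  rw [mem_wt] at hv
  rw [mem_gr, sum_lie, Finset.sum_congr rfl fun i _ => hv i, ← Finset.sum_smul]
  simp

lemma ω_mem (p : PF k x ω E F) (i : ι) : ω i ∈ wt k ω 0 := by
  rw [mem_wt]; intro j; simp [p.comm]

lemma x_mem (p : PF k x ω E F) : x ∈ wt k ω 0 := by
  rw [p.zx]; simp

lemma ind (p : PF k x ω E F) : iSupIndep (wt k ω) := by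
  let f : ι → Module.End k g := fun i => LieAlgebra.ad k g (ω i)
  have hc : ∀ i j, Commute (f j) (f i) := by
    intro i j
    refine LinearMap.ext fun v => ?_
    change ⁅ω j, ⁅ω i, v⁆⁆ = ⁅ω i, ⁅ω j, v⁆⁆
    rw [leibniz_lie, p.comm, zero_lie, zero_add]
  have h : iSupIndep fun χ : ι → k ↦ ⨅ i, (f i).maxGenEigenspace (χ i) :=
    Module.End.independent_iInf_maxGenEigenspace_of_forall_mapsTo f (by
      intro i j φ
      exact Module.End.mapsTo_maxGenEigenspace_of_comm (hc i j) φ)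
  have hinj : Function.Injective (fun (μ : ι → ℤ) i => (μ i : k)) := by
    intro μ ν h
    ext i
    exact Int.cast_injective (congrFun h i)
  have h2 := h.comp hinj
  have h3 : ∀ μ : ι → ℤ, wt k ω μ ≤ ⨅ i, (f i).maxGenEigenspace (μ i : k) := by
    intro μ
    refine iInf_mono fun i => ?_
    exact (f i).eigenspace_le_maxGenEigenspace (μ := (μ i : k))
  exact h2.mono h3

lemma lieGr (p : PF k x ω E F) : LieGr (gr k (∑ i, ω i)) where
  top := by
    rw [eq_top_iff, ← p.top]
    exact iSup_le fun μ => (wt_le ω μ).trans (le_iSup _ _)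
  ind := gr_ind _
  lie i j u v hu hv := gr_lie hu hv

lemma gr_le (p : PF k x ω E F) (j : ℤ) :
    gr k (∑ i, ω i) j ≤ part (wt k ω) {μ | ∑ i, μ i = j} := by
  intro v hv
  have h : v ∈ part (wt k ω) Set.univ := by rw [part_univ, p.top]; trivial
  obtain ⟨a, ha, b, hb, e⟩ := split (Q := {μ | ∑ i, μ i = j}) (R := {μ | ∑ i, μ i ≠ j})
    (by intro μ _; simp; tauto) h
  have ha' : a ∈ part (gr k (∑ i, ω i)) {j} := by
    refine part_le ?_ ha
    intro μ hμ
    refine (wt_le ω μ).trans (le_part ?_)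
    exact hμ
  have hb' : b ∈ part (gr k (∑ i, ω i)) {j}ᶜ := by
    refine part_le ?_ hb
    intro μ hμ
    refine (wt_le ω μ).trans (le_part ?_)
    exact hμ
  have hb2 : b ∈ part (gr k (∑ i, ω i)) {j} := by
    have : b = v - a := by rw [e]; abel
    rw [this]
    exact sub_mem (mem_part (Set.mem_singleton j) hv) ha'
  have : b = 0 := part_disj (gr_ind (k := k) (∑ i, ω i)) disjoint_compl_right hb2 hb'
  rw [e, this, add_zero]
  exact ha

lemma gr_zero (p : PF k x ω E F) : gr k (∑ i, ω i) 0 = wt k ω 0 := by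
  apply le_antisymm
  · refine (p.gr_le 0).trans (part_le fun μ hμ => ?_)
    by_cases h : wt k ω μ = ⊥
    · rw [h]; exact bot_le
    · have : μ = 0 := by
        rcases p.sgn μ h with h | h
        · ext i
          exact (Finset.sum_eq_zero_iff_of_nonneg (fun i _ => h i)).mp hμ i (Finset.mem_univ _)
        · ext i
          exact (Finset.sum_eq_zero_iff_of_nonpos (fun i _ => h i)).mp hμ i (Finset.mem_univ _)
      rw [this]
  · have := wt_le (k := k) ω 0
    simpa using this

lemma wt_line (p : PF k x ω E F) {μ : ι → ℤ} (hμ : μ ≠ 0) {e v : g} (he : e ∈ wt k ω μ)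
    (he0 : e ≠ 0) (hv : v ∈ wt k ω μ) : ∃ c : k, v = c • e := by
  have h := p.line μ hμ
  rw [finrank_le_one_iff] at h
  obtain ⟨w, hw⟩ := h
  obtain ⟨a, ha⟩ := hw ⟨e, he⟩
  obtain ⟨b, hb⟩ := hw ⟨v, hv⟩
  have ha' : a • (w : g) = e := congrArg Subtype.val ha
  have hb' : b • (w : g) = v := congrArg Subtype.val hb
  have ha0 : a ≠ 0 := by rintro rfl; exact he0 (by rw [← ha']; simp)
  refine ⟨b * a⁻¹, ?_⟩
  rw [← ha', ← hb', smul_smul]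
  field_simp

lemma gr_one (p : PF k x ω E F) {v : g} (hv : v ∈ gr k (∑ i, ω i) 1) :
    ∃ c : ι → k, v = ∑ i, c i • E i := by
  have : v ∈ Submodule.span k (Set.range E) := by
    refine ((p.gr_le 1).trans (part_le fun μ hμ => ?_)) hv
    by_cases h : wt k ω μ = ⊥
    · rw [h]; exact bot_le
    · have : ∃ i, μ = Pi.single i 1 := by
        change ∑ i, μ i = 1 at hμ
        rcases p.sgn μ h with h | h
        · have : ∃ i, 0 < μ i := by
            by_contra hc
            push Not at hc
            have := Finset.sum_nonpos (s := Finset.univ) fun i _ => hc i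
            omega
          obtain ⟨i, hi⟩ := this
          have h1 := Finset.sum_erase_add (s := Finset.univ) (f := μ) (a := i) (Finset.mem_univ _)
          have h2 : 0 ≤ ∑ j ∈ Finset.univ.erase i, μ j := Finset.sum_nonneg fun j _ => h j
          have h3 : ∑ j ∈ Finset.univ.erase i, μ j = 0 := by omega
          refine ⟨i, ?_⟩
          ext j
          by_cases hj : j = i
          · subst hj; simp; omega
          · rw [Pi.single_eq_of_ne hj]
            exact (Finset.sum_eq_zero_iff_of_nonneg fun j _ => h j).mp h3 j (by simp [hj])
        · have := Finset.sum_nonpos (s := Finset.univ) fun i _ => h i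
          omega
      obtain ⟨i, rfl⟩ := this
      intro w hw
      obtain ⟨c, rfl⟩ := p.wt_line (by simp) (p.E_mem i) (p.E_ne i) hw
      exact Submodule.smul_mem _ _ (Submodule.subset_span ⟨i, rfl⟩)
  rw [Submodule.mem_span_range_iff_exists_fun] at this
  obtain ⟨c, hc⟩ := this
  exact ⟨c, hc.symm⟩

lemma E_ind (p : PF k x ω E F) {c : ι → k} (h : ∑ i, c i • E i = 0) (i : ι) : c i = 0 := by
  have hli : LinearIndependent k E := by
    have := (p.ind.comp (f := fun i : ι => (Pi.single i 1 : ι → ℤ)) (by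
      intro i j h
      by_contra hij
      have := congrFun h i
      simp [hij] at this))
    exact this.linearIndependent _ p.E_mem p.E_ne
  exact (Fintype.linearIndependent_iff.mp hli) c h i

lemma ab (p : PF k x ω E F) {u v : g} (hu : u ∈ wt k ω 0) (hv : v ∈ wt k ω 0) : ⁅u, v⁆ = 0 := by
  obtain ⟨a, ha⟩ := (Submodule.mem_span_range_iff_exists_fun k).mp (p.span hu)
  rw [← ha, sum_lie]
  refine Finset.sum_eq_zero fun i _ => ?_
  rw [mem_wt] at hv
  simp [hv i]

lemma lie_ωE (p : PF k x ω E F) (i j : ι) : ⁅ω i, E j⁆ = if i = j then E j else 0 := by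
  have := mem_wt.mp (p.E_mem j) i
  rw [this, Pi.single_apply]
  split_ifs <;> simp

lemma lie_sum_E (p : PF k x ω E F) (a b : ι → k) :
    ⁅∑ i, a i • ω i, ∑ j, b j • E j⁆ = ∑ i, (a i * b i) • E i := by
  rw [sum_lie]
  refine Finset.sum_congr rfl fun i _ => ?_
  rw [lie_sum, Finset.sum_eq_single i]
  · simp [p.lie_ωE, smul_smul, mul_comm]
  · intro j _ hj
    simp [p.lie_ωE, hj.symm]
  · simp

lemma inj0 (p : PF k x ω E F) {y : g} (hy : y ∈ wt k ω 0) (h : ⁅y, ∑ i, E i⁆ = 0) : y = 0 := by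
  obtain ⟨a, rfl⟩ := (Submodule.mem_span_range_iff_exists_fun k).mp (p.span hy)
  have h1 := p.lie_sum_E a 1
  simp only [Pi.one_apply, one_smul, mul_one] at h1
  rw [h] at h1
  have := p.E_ind h1.symm
  simp [this]

lemma nil (p : PF k x ω E F) {y : g} (hy : y ∈ wt k ω 0)
    (h : IsNilpotent (LieAlgebra.ad k g y)) : y = 0 := by
  obtain ⟨a, rfl⟩ := (Submodule.mem_span_range_iff_exists_fun k).mp (p.span hy)
  obtain ⟨n, hn⟩ := h
  refine Finset.sum_eq_zero fun i _ => ?_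
  have : ∀ n : ℕ, (LieAlgebra.ad k g (∑ i, a i • ω i) ^ n) (E i) = (a i) ^ n • E i := by
    intro n
    induction n with
    | zero => simp
    | succ n ih =>
      rw [pow_succ', Module.End.mul_apply, ih, map_smul, LieAlgebra.ad_apply]
      have := p.lie_sum_E a (Pi.single i 1)
      simp only [Pi.single_apply, ite_smul, one_smul, zero_smul, Finset.sum_ite_eq',
        Finset.mem_univ, if_true, mul_ite, mul_one, mul_zero] at this
      rw [this, smul_smul, pow_succ]
  have h1 := this n
  rw [hn, LinearMap.zero_apply, eq_comm, smul_eq_zero] at h1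
  rcases h1 with h1 | h1
  · rw [eq_zero_of_pow_eq_zero h1, zero_smul]
  · exact absurd h1 (p.E_ne i)

lemma e_mem (p : PF k x ω E F) : ∑ i, E i ∈ gr k (∑ i, ω i) 1 := by
  refine sum_mem fun i _ => ?_
  have := wt_le ω _ (p.E_mem i)
  simpa using this

lemma F_mem' (p : PF k x ω E F) : F ∈ gr k (∑ i, ω i) (-1) := by
  rw [mem_gr, p.F_mem]; simp

lemma h_mem (ω : ι → g) : ∑ i, ω i ∈ gr k (∑ i, ω i) 0 := by
  rw [mem_gr]; simp

lemma triple (p : PF k x ω E F) (h0 : ∑ i, ω i ≠ 0) :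
    IsSl2Triple ((2 : k) • ∑ i, ω i) (∑ i, E i) F where
  h_ne_zero := by simp [h0]
  lie_e_f := p.sl2
  lie_h_e_nsmul := by
    have := mem_gr.mp p.e_mem
    rw [smul_lie, this]
    simp [two_smul]
  lie_h_f_nsmul := by
    rw [smul_lie, p.F_mem]
    simp [two_smul]

lemma inj_e (p : PF k x ω E F) {j : ℤ} (hj : j < 0) {v : g} (hv : v ∈ gr k (∑ i, ω i) j)
    (h : ⁅∑ i, E i, v⁆ = 0) : v = 0 := by
  have hv' := mem_gr.mp hv
  by_cases h0 : ∑ i, ω i = 0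
  · rw [h0, zero_lie, eq_comm, smul_eq_zero] at hv'
    rcases hv' with h | h
    · simp at h; omega
    · exact h
  by_contra hne
  have P : (p.triple h0).HasPrimitiveVectorWith v (2 * j : k) :=
    ⟨hne, by rw [smul_lie, hv', smul_smul], h⟩
  obtain ⟨n, hn⟩ := P.exists_nat
  have : (2 * j : ℤ) = n := by exact_mod_cast hn
  omega

lemma inj_f (p : PF k x ω E F) {j : ℤ} (hj : 0 < j) {v : g} (hv : v ∈ gr k (∑ i, ω i) j)
    (h : ⁅F, v⁆ = 0) : v = 0 := by
  have hv' := mem_gr.mp hv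
  by_cases h0 : ∑ i, ω i = 0
  · rw [h0, zero_lie, eq_comm, smul_eq_zero] at hv'
    rcases hv' with h | h
    · simp at h; omega
    · exact h
  by_contra hne
  have P : (p.triple h0).symm.HasPrimitiveVectorWith v (- (2 * j) : k) :=
    ⟨hne, by rw [neg_lie, smul_lie, hv', smul_smul, neg_smul], h⟩
  obtain ⟨n, hn⟩ := P.exists_nat
  have : (-(2 * j) : ℤ) = n := by exact_mod_cast hn
  omega

lemma x_surj (p : PF k x ω E F) {j : ℤ} (hj : j ≠ 0) {r : g} (hr : r ∈ gr k (∑ i, ω i) j) :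
    ∃ z ∈ gr k (∑ i, ω i) j, ⁅x, z⁆ = r := by
  have hx : x ∈ gr k (∑ i, ω i) 0 := by rw [p.gr_zero]; exact p.x_mem
  have hm : ∀ v ∈ gr k (∑ i, ω i) j, LieAlgebra.ad k g x v ∈ gr k (∑ i, ω i) j := by
    intro v hv
    have := gr_lie hx hv
    rwa [zero_add] at this
  let f := (LieAlgebra.ad k g x : g →ₗ[k] g).restrict hm
  have hf : Function.Injective f := by
    rw [injective_iff_map_eq_zero]
    rintro ⟨v, hv⟩ h
    have h' : ⁅x, v⁆ = 0 := congrArg Subtype.val h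
    rw [← p.zx, ← p.gr_zero] at h'
    have : v = 0 := part_disj (P := {0}) (Q := {j}) (gr_ind (k := k) (∑ i, ω i)) (by simpa using hj.symm)
      (mem_part (Set.mem_singleton 0) h') (mem_part (Set.mem_singleton j) hv)
    exact Subtype.ext this
  obtain ⟨⟨z, hz⟩, h⟩ := LinearMap.surjective_of_injective hf ⟨r, hr⟩
  exact ⟨z, hz, congrArg Subtype.val h⟩

end PF
end PNR
end PNR

section PNR
set_option linter.unusedSectionVars false
variable {k : Type*} [Field k] [CharZero k]
variable {g : Type*} [LieRing g] [LieAlgebra k g] [FiniteDimensional k g]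

namespace PNR
variable {ι : Type*} [Fintype ι] [DecidableEq ι]

/-- character of the torus -/
def chr (c : ι → kˣ) (μ : ι → ℤ) : kˣ := ∏ i, (c i) ^ (μ i)

lemma chr_add (c : ι → kˣ) (μ ν : ι → ℤ) : chr c (μ + ν) = chr c μ * chr c ν := by
  simp [chr, zpow_add, Finset.prod_mul_distrib]

lemma chr_zero (c : ι → kˣ) : chr c 0 = 1 := by simp [chr]

lemma chr_sum {J : Type*} (c : ι → kˣ) (s : Finset J) (μ : J → ι → ℤ) :
    chr c (∑ j ∈ s, μ j) = ∏ j ∈ s, chr c (μ j) := by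
  classical
  induction s using Finset.induction_on with
  | empty => simp [chr_zero]
  | insert a s ha ih => rw [Finset.sum_insert ha, Finset.prod_insert ha, chr_add, ih]

lemma chr_pow (c : ι → kˣ) (n : ℕ) (μ : ι → ℤ) : chr (c ^ n) μ = chr c μ ^ n := by
  simp only [chr, Pi.pow_apply, ← Finset.prod_pow]
  refine Finset.prod_congr rfl fun i _ => ?_
  rw [← zpow_natCast, ← zpow_natCast, zpow_comm]

lemma chr_single (c : ι → kˣ) (i : ι) : chr c (Pi.single i 1) = c i := by
  rw [chr, Finset.prod_eq_single i]
  · simp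
  · intro j _ hj; simp [hj]
  · simp

/-- `s` acts on each weight space by the character `c`. -/
def IsD (ω : ι → g) (c : ι → kˣ) (s : g ≃ₗ[k] g) : Prop :=
  s ∈ Au k g ∧ ∀ μ, ∀ v ∈ wt k ω μ, s v = (chr c μ : k) • v

lemma Au.pow_ad {φ : g ≃ₗ[k] g} (hφ : φ ∈ Au k g) (z v : g) (n : ℕ) :
    φ ((LieAlgebra.ad k g z ^ n) v) = (LieAlgebra.ad k g (φ z) ^ n) (φ v) := by
  induction n with
  | zero => simp
  | succ n ih =>
    rw [pow_succ', pow_succ', Module.End.mul_apply, Module.End.mul_apply, LieAlgebra.ad_apply,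
      hφ, ih, LieAlgebra.ad_apply]

lemma Au.nilp {φ : g ≃ₗ[k] g} (hφ : φ ∈ Au k g) {z : g}
    (hz : IsNilpotent (LieAlgebra.ad k g z)) : IsNilpotent (LieAlgebra.ad k g (φ z)) := by
  obtain ⟨n, hn⟩ := hz
  refine ⟨n, LinearMap.ext fun v => ?_⟩
  have := Au.pow_ad hφ z (φ⁻¹ v) n
  have e : φ (φ⁻¹ v) = v := by rw [← LinearEquiv.mul_apply]; simp
  rw [hn, e] at this
  simpa using this.symm

lemma Au.nilp_iff {φ : g ≃ₗ[k] g} (hφ : φ ∈ Au k g) {z : g} :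
    IsNilpotent (LieAlgebra.ad k g (φ z)) ↔ IsNilpotent (LieAlgebra.ad k g z) := by
  refine ⟨fun h => ?_, Au.nilp hφ⟩
  have := Au.nilp (inv_mem hφ) h
  have e : φ⁻¹ (φ z) = z := by rw [← LinearEquiv.mul_apply]; simp
  rwa [e] at this

section grading
variable {A : ℤ → Submodule k g}

lemma LieGr.nilp_dn (hA : LieGr A) {z : g} (hz : z ∈ dn A (-1)) :
    IsNilpotent (LieAlgebra.ad k g z) := by
  rw [← up_neg] at hz
  exact hA.neg.nilp hz

lemma LieGr.dn_bot {N : ℕ}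
    (hN : ∀ i : ℤ, (N : ℤ) < |i| → A i = ⊥) : dn A (-(N + 1)) = ⊥ := by
  rw [eq_bot_iff]
  refine part_le fun i hi => ?_
  rw [hN i (by rw [lt_abs]; simp at hi; omega)]

lemma split_dn {j : ℤ} {w : g} (hw : w ∈ dn A j) :
    ∃ a ∈ A j, ∃ b ∈ dn A (j - 1), w = a + b := by
  obtain ⟨a, ha, b, hb, e⟩ := split (Q := {j}) (R := Set.Iic (j - 1))
    (by intro i hi; simp at hi ⊢; omega) hw
  rw [part_singleton] at ha
  exact ⟨a, ha, b, hb, e⟩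

lemma split_up {j : ℤ} {w : g} (hw : w ∈ up A j) :
    ∃ a ∈ A j, ∃ b ∈ up A (j + 1), w = a + b := by
  obtain ⟨a, ha, b, hb, e⟩ := split (Q := {j}) (R := Set.Ici (j + 1))
    (by intro i hi; simp at hi ⊢; omega) hw
  rw [part_singleton] at ha
  exact ⟨a, ha, b, hb, e⟩

lemma mem_dn {i j : ℤ} (h : i ≤ j) {v : g} (hv : v ∈ A i) : v ∈ dn A j :=
  mem_part (A := A) (P := Set.Iic j) (Set.mem_Iic.mpr h) hv
lemma mem_up {i j : ℤ} (h : j ≤ i) {v : g} (hv : v ∈ A i) : v ∈ up A j :=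
  mem_part (A := A) (P := Set.Ici j) (Set.mem_Ici.mpr h) hv
lemma dn_mono {i j : ℤ} (h : i ≤ j) {v : g} (hv : v ∈ dn A i) : v ∈ dn A j :=
  part_mono (Set.Iic_subset_Iic.mpr h) hv
lemma up_mono {i j : ℤ} (h : j ≤ i) {v : g} (hv : v ∈ up A i) : v ∈ up A j :=
  part_mono (Set.Ici_subset_Ici.mpr h) hv

lemma LieGr.up_dn (hA : LieGr A) {i j : ℤ} (h : i < j) {v : g} (h1 : v ∈ up A j)
    (h2 : v ∈ dn A i) : v = 0 :=
  part_disj hA.ind (by rw [Set.disjoint_left]; intro a ha hb; simp at ha hb; omega) h1 h2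

lemma LieGr.lie_dn (hA : LieGr A) {i j l : ℤ} (h : i + j ≤ l) {u v : g} (hu : u ∈ dn A i)
    (hv : v ∈ dn A j) : ⁅u, v⁆ ∈ dn A l :=
  hA.lie_part (by intro a ha b hb; simp at ha hb ⊢; omega) hu hv

lemma LieGr.lie_up (hA : LieGr A) {i j l : ℤ} (h : l ≤ i + j) {u v : g} (hu : u ∈ up A i)
    (hv : v ∈ up A j) : ⁅u, v⁆ ∈ up A l :=
  hA.lie_part (by intro a ha b hb; simp at ha hb ⊢; omega) hu hv

lemma LieGr.isCompl (hA : LieGr A) (j : ℤ) : IsCompl (dn A j) (up A (j + 1)) := by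
  constructor
  · rw [Submodule.disjoint_def]
    intro v h1 h2
    exact hA.up_dn (by omega) h2 h1
  · rw [codisjoint_iff, eq_top_iff, ← hA.top]
    refine iSup_le fun i => ?_
    rcases le_or_gt i j with h | h
    · exact le_trans (b := dn A j) (fun v hv => mem_dn h hv) le_sup_left
    · exact le_trans (b := up A (j + 1)) (fun v hv => mem_up h hv) le_sup_right

lemma LieGr.ext (hA : LieGr A) {f f' : g →ₗ[k] g} (h : ∀ j, ∀ v ∈ A j, f v = f' v) : f = f' := by
  have : (⊤ : Submodule k g) ≤ LinearMap.eqLocus f f' := by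
    rw [← hA.top]
    exact iSup_le fun j v hv => h j v hv
  exact LinearMap.ext fun v => this trivial

lemma LieGr.pow_mem (hA : LieGr A) {i j : ℤ} {a v : g} (ha : a ∈ A i) (hv : v ∈ A j) (n : ℕ) :
    (LieAlgebra.ad k g a ^ n) v ∈ A (j + n * i) := by
  induction n with
  | zero => simpa using hv
  | succ n ih =>
    rw [pow_succ', Module.End.mul_apply, LieAlgebra.ad_apply]
    have := hA.lie _ _ _ _ ha ih
    have e : i + (j + n * i) = j + ((n + 1 : ℕ) : ℤ) * i := by push_cast; ring
    rwa [e] at this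

end grading

namespace PF
variable {x : g} {ω E : ι → g} {F : g}

lemma ext (p : PF k x ω E F) {s t : g ≃ₗ[k] g} (h : ∀ μ, ∀ v ∈ wt k ω μ, s v = t v) : s = t := by
  have : (⊤ : Submodule k g) ≤ LinearMap.eqLocus (s : g →ₗ[k] g) (t : g →ₗ[k] g) := by
    rw [← p.top]
    exact iSup_le fun j v hv => h j v hv
  exact LinearEquiv.ext fun v => this trivial

lemma exists_D (p : PF k x ω E F) (c : ι → kˣ) : ∃ s, IsD ω c s := by
  classical
  have hI : DirectSum.IsInternal (wt k ω) :=
    (DirectSum.isInternal_submodule_iff_iSupIndep_and_iSup_eq_top _).mpr ⟨p.ind, p.top⟩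
  let Φ := LinearEquiv.ofBijective (DirectSum.coeLinearMap (wt k ω)) hI
  have key : ∀ c : ι → kˣ, ∃ f : g →ₗ[k] g, ∀ μ, ∀ v ∈ wt k ω μ, f v = (chr c μ : k) • v := by
    intro c
    refine ⟨(DirectSum.toModule k (ι → ℤ) g
      (fun μ => (chr c μ : k) • (wt k ω μ).subtype)) ∘ₗ (Φ.symm : g →ₗ[k] _), ?_⟩
    intro μ v hv
    have : Φ.symm v = DirectSum.lof k _ _ μ ⟨v, hv⟩ := by
      rw [LinearEquiv.symm_apply_eq]
      exact (DirectSum.coeLinearMap_lof (wt k ω) μ ⟨v, hv⟩).symm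
    simp only [LinearMap.comp_apply, LinearEquiv.coe_coe, this, DirectSum.toModule_lof]
    rfl
  obtain ⟨f, hf⟩ := key c
  obtain ⟨f', hf'⟩ := key c⁻¹
  have hinv : ∀ μ, (chr c⁻¹ μ : k) * chr c μ = 1 := by
    intro μ
    rw [← Units.val_mul]
    simp [chr]
  have hext : ∀ f f' : g →ₗ[k] g, (∀ μ, ∀ v ∈ wt k ω μ, f v = f' v) → f = f' := by
    intro f f' h
    have : (⊤ : Submodule k g) ≤ LinearMap.eqLocus f f' := by
      rw [← p.top]
      exact iSup_le fun j v hv => h j v hv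
    exact LinearMap.ext fun v => this trivial
  let s : g ≃ₗ[k] g := LinearEquiv.ofLinearMap f f'
    (hext _ _ fun μ v hv => by
      rw [LinearMap.comp_apply, hf' μ v hv, map_smul, hf μ v hv, smul_smul, hinv, one_smul,
        LinearMap.id_apply])
    (hext _ _ fun μ v hv => by
      rw [LinearMap.comp_apply, hf μ v hv, map_smul, hf' μ v hv, smul_smul, mul_comm, hinv,
        one_smul, LinearMap.id_apply])
  refine ⟨s, ?_, hf⟩
  have h1 : ∀ μ, ∀ u ∈ wt k ω μ, ∀ v, f ⁅u, v⁆ = ⁅f u, f v⁆ := by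
    intro μ u hu v
    have := hext (f ∘ₗ (LieAlgebra.ad k g u : g →ₗ[k] g)) ((LieAlgebra.ad k g (f u)) ∘ₗ f) (by
      intro ν w hw
      simp only [LinearMap.comp_apply, LieAlgebra.ad_apply]
      rw [hf _ _ (wt_lie hu hw), hf _ _ hu, hf _ _ hw, chr_add, smul_lie, lie_smul, smul_smul,
        Units.val_mul])
    exact LinearMap.congr_fun this v
  intro u v
  have := hext (f ∘ₗ (LieAlgebra.ad k g v : g →ₗ[k] g)) ((LieAlgebra.ad k g (f v)) ∘ₗ f) (by
      intro ν w hw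
      simp only [LinearMap.comp_apply, LieAlgebra.ad_apply]
      rw [← lie_skew, map_neg, h1 _ _ hw, lie_skew])
  have h2 := LinearMap.congr_fun this u
  simp only [LinearMap.comp_apply, LieAlgebra.ad_apply] at h2
  change f ⁅u, v⁆ = ⁅f u, f v⁆
  rw [← lie_skew, map_neg, h2, lie_skew]

lemma isD_gr (p : PF k x ω E F) {c : ι → kˣ} {s : g ≃ₗ[k] g} (hs : IsD ω c s) {j : ℤ} {v : g}
    (hv : v ∈ gr k (∑ i, ω i) j) : s v ∈ gr k (∑ i, ω i) j := by
  have : part (wt k ω) {μ | ∑ i, μ i = j} ≤ (gr k (∑ i, ω i) j).comap (s : g →ₗ[k] g) := by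
    refine part_le fun μ hμ w hw => ?_
    change s w ∈ gr k (∑ i, ω i) j
    rw [hs.2 μ w hw]
    have := wt_le ω μ hw
    rw [hμ] at this
    exact Submodule.smul_mem _ _ this
  exact this (p.gr_le j hv)

lemma isD_part (p : PF k x ω E F) {c : ι → kˣ} {s : g ≃ₗ[k] g} (hs : IsD ω c s) {P : Set ℤ} {v : g}
    (hv : v ∈ part (gr k (∑ i, ω i)) P) : s v ∈ part (gr k (∑ i, ω i)) P := by
  have : part (gr k (∑ i, ω i)) P ≤ (part (gr k (∑ i, ω i)) P).comap (s : g →ₗ[k] g) :=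
    part_le fun j hj w hw => mem_part hj (p.isD_gr hs hw)
  exact this hv

/-- nilpotent elements of `dn 0` lie in `dn (-1)` -/
lemma nil_dn (p : PF k x ω E F) {z : g} (hz : z ∈ dn (gr k (∑ i, ω i)) 0)
    (hn : IsNilpotent (LieAlgebra.ad k g z)) : z ∈ dn (gr k (∑ i, ω i)) (-1) := by
  have hA := p.lieGr
  obtain ⟨a, ha, b, hb, e⟩ := split_dn hz
  have hb : b ∈ dn (gr k (∑ i, ω i)) (-1) := hb
  obtain ⟨n, hn⟩ := hn
  have key : ∀ n : ℕ, ∀ j, ∀ v ∈ gr k (∑ i, ω i) j,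
      (LieAlgebra.ad k g z ^ n) v - (LieAlgebra.ad k g a ^ n) v
        ∈ dn (gr k (∑ i, ω i)) (j - 1) := by
    intro n j v hv
    induction n with
    | zero => simp
    | succ n ih =>
      have h1 := hA.pow_mem ha hv n
      have e1 : j + (n : ℤ) * 0 = j := by ring
      rw [e1] at h1
      rw [pow_succ', pow_succ', Module.End.mul_apply, Module.End.mul_apply, LieAlgebra.ad_apply,
        LieAlgebra.ad_apply]
      have e2 : ⁅z, (LieAlgebra.ad k g z ^ n) v⁆ - ⁅a, (LieAlgebra.ad k g a ^ n) v⁆ =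
          ⁅z, (LieAlgebra.ad k g z ^ n) v - (LieAlgebra.ad k g a ^ n) v⁆
            + ⁅b, (LieAlgebra.ad k g a ^ n) v⁆ := by
        have : b = z - a := by rw [e]; abel
        rw [this, lie_sub, sub_lie]; abel
      rw [e2]
      exact add_mem (hA.lie_dn (by omega) hz ih) (hA.lie_dn (by omega) hb (mem_dn le_rfl h1))
  have hna : LieAlgebra.ad k g a ^ n = 0 := by
    refine hA.ext fun j v hv => ?_
    have h1 := key n j v hv
    rw [hn, LinearMap.zero_apply, zero_sub, neg_mem_iff] at h1
    have h2 := hA.pow_mem ha hv n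
    have e1 : j + (n : ℤ) * 0 = j := by ring
    rw [e1] at h2
    exact hA.up_dn (by omega) (mem_up le_rfl h2) h1
  have : a = 0 := p.nil (by rw [← p.gr_zero]; exact ha) ⟨n, hna⟩
  rw [e, this, zero_add]
  exact hb

end PF
end PNR
end PNR

section PNR
set_option linter.unusedSectionVars false
variable {k : Type*} [Field k] [CharZero k]
variable {g : Type*} [LieRing g] [LieAlgebra k g] [FiniteDimensional k g]

namespace PNR
variable {ι : Type*} [Fintype ι] [DecidableEq ι]

lemma inv_app (s : g ≃ₗ[k] g) (v : g) : s⁻¹ (s v) = v := by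
  rw [← LinearEquiv.mul_apply]; simp

lemma app_inv (s : g ≃ₗ[k] g) (v : g) : s (s⁻¹ v) = v := by
  rw [← LinearEquiv.mul_apply]; simp

namespace PF
variable {x : g} {ω E : ι → g} {F : g}

lemma x_gr (p : PF k x ω E F) : x ∈ gr k (∑ i, ω i) 0 := by rw [p.gr_zero]; exact p.x_mem

lemma xe_dn (p : PF k x ω E F) : x + ∑ i, E i ∈ dn (gr k (∑ i, ω i)) 1 :=
  add_mem (mem_dn (by omega) p.x_gr) (mem_dn le_rfl p.e_mem)

lemma xe_up (p : PF k x ω E F) : x + ∑ i, E i ∈ up (gr k (∑ i, ω i)) 0 :=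
  add_mem (mem_up le_rfl p.x_gr) (mem_up (by omega) p.e_mem)

lemma comp_top (p : PF k x ω E F) {j : ℤ} {w a : g} (ha : a ∈ gr k (∑ i, ω i) j)
    (hw : w - a ∈ dn (gr k (∑ i, ω i)) (j - 1)) (n : ℕ) :
    (LieAlgebra.ad k g (x + ∑ i, E i) ^ n) w - (LieAlgebra.ad k g (∑ i, E i) ^ n) a ∈
      dn (gr k (∑ i, ω i)) (j + n - 1) := by
  have hA := p.lieGr
  induction n with
  | zero => simpa using hw
  | succ n ih =>
    have h1 := hA.pow_mem p.e_mem ha n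
    rw [mul_one] at h1
    rw [pow_succ', pow_succ', Module.End.mul_apply, Module.End.mul_apply, LieAlgebra.ad_apply,
      LieAlgebra.ad_apply]
    generalize (LieAlgebra.ad k g (x + ∑ i, E i) ^ n) w = w' at *
    generalize (LieAlgebra.ad k g (∑ i, E i) ^ n) a = a' at *
    have e2 : ⁅x + ∑ i, E i, w'⁆ - ⁅∑ i, E i, a'⁆ = ⁅x + ∑ i, E i, w' - a'⁆ + ⁅x, a'⁆ := by
      rw [lie_sub, add_lie, add_lie]; abel
    rw [e2]
    push_cast
    exact add_mem (hA.lie_dn (by omega) p.xe_dn ih)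
      (hA.lie_dn (by omega) (mem_dn le_rfl p.x_gr) (mem_dn le_rfl h1))

lemma inj_e_pow (p : PF k x ω E F) (n : ℕ) {a : g} (ha : a ∈ gr k (∑ i, ω i) (-n))
    (h : (LieAlgebra.ad k g (∑ i, E i) ^ n) a = 0) : a = 0 := by
  have key : ∀ m : ℕ, m ≤ n → (LieAlgebra.ad k g (∑ i, E i) ^ m) a = 0 → a = 0 := by
    intro m
    induction m with
    | zero => intro _ h; simpa using h
    | succ m ih =>
      intro hm h
      refine ih (by omega) ?_
      rw [pow_succ', Module.End.mul_apply, LieAlgebra.ad_apply] at h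
      have h1 := p.lieGr.pow_mem p.e_mem ha m
      exact p.inj_e (by omega) h1 h
  exact key n le_rfl h

lemma up0_dn (p : PF k x ω E F) {φ : g ≃ₗ[k] g} (hφ : φ ∈ Au k g) {c : k} (hc : c ≠ 0)
    (hx : φ x = c • (x + ∑ i, E i)) {v : g} (hv : v ∈ up (gr k (∑ i, ω i)) 0)
    (hφv : φ v ∈ dn (gr k (∑ i, ω i)) (-1)) : v = 0 := by
  have hA := p.lieGr
  have key : ∀ n : ℕ, φ v ∈ dn (gr k (∑ i, ω i)) (-(n + 1)) := by
    intro n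
    induction n with
    | zero => simpa using hφv
    | succ n ih =>
      obtain ⟨a, ha, b, hb, e⟩ := split_dn ih
      have h1 : (LieAlgebra.ad k g x ^ (n + 1)) v ∈ up (gr k (∑ i, ω i)) 1 := by
        have hv1 : ⁅x, v⁆ ∈ up (gr k (∑ i, ω i)) 1 := by
          obtain ⟨a0, ha0, b0, hb0, e0⟩ := split_up hv
          rw [p.gr_zero, p.zx] at ha0
          rw [e0, lie_add, ha0, zero_add]
          exact hA.lie_up (by omega) (mem_up le_rfl p.x_gr) hb0
        rw [pow_succ, Module.End.mul_apply, LieAlgebra.ad_apply]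
        have := hA.pow_up (mem_up le_rfl p.x_gr) n hv1
        simpa using this
      have h2 := Au.nilp hφ (hA.nilp h1)
      rw [Au.pow_ad hφ, hx, map_smul, smul_pow, LinearMap.smul_apply] at h2
      have h3 := p.comp_top ha (w := φ v) (by rw [e]; simpa using hb) (n + 1)
      have e1 : (-((n : ℤ) + 1) + (n + 1 : ℕ) - 1) = -1 := by push_cast; ring
      rw [e1] at h3
      have h4 := hA.pow_mem p.e_mem ha (n + 1)
      have e2 : (-((n : ℤ) + 1) + (n + 1 : ℕ) * 1) = 0 := by push_cast; ring
      rw [e2] at h4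
      have h5 : (LieAlgebra.ad k g (x + ∑ i, E i) ^ (n + 1)) (φ v) ∈ dn (gr k (∑ i, ω i)) 0 := by
        have := add_mem (dn_mono (j := 0) (by omega) h3) (mem_dn (j := 0) le_rfl h4)
        simpa using this
      have h6 := p.nil_dn (Submodule.smul_mem _ (c ^ (n + 1)) h5) h2
      have h7 := (Submodule.smul_mem_iff _ (pow_ne_zero (n + 1) hc)).mp h6
      have h8 : (LieAlgebra.ad k g (∑ i, E i) ^ (n + 1)) a = 0 := by
        refine hA.up_dn (i := -1) (j := 0) (by omega) (mem_up le_rfl h4) ?_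
        have := sub_mem h7 h3
        simpa using this
      have h9 : a = 0 := p.inj_e_pow (n + 1) (by push_cast; exact ha) h8
      rw [e, h9, zero_add]
      refine dn_mono ?_ hb
      push_cast; omega
  obtain ⟨N, hN⟩ := hA.exists_bound
  have := key N
  rw [LieGr.dn_bot hN] at this
  simpa using this

lemma eig_bot (p : PF k x ω E F) {μ : k} (hμ : ∀ j : ℤ, (j : k) ≠ μ) :
    Module.End.eigenspace (LieAlgebra.ad k g (∑ i, ω i)) μ = ⊥ := by
  have h := (Module.End.eigenspaces_iSupIndep (LieAlgebra.ad k g (∑ i, ω i))) μ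
  have h2 : (⨆ (j) (_ : j ≠ μ), Module.End.eigenspace (LieAlgebra.ad k g (∑ i, ω i)) j) = ⊤ := by
    rw [eq_top_iff, ← p.lieGr.top]
    exact iSup_le fun j => le_iSup₂_of_le (j : k) (hμ j) le_rfl
  rw [h2] at h
  exact disjoint_top.mp h

lemma exists_v (p : PF k x ω E F) {φ : g ≃ₗ[k] g} (hφ : φ ∈ Au k g) {c : k} (hc : c ≠ 0)
    (hx : φ x = c • (x + ∑ i, E i)) : ∃ v ∈ Un (gr k (∑ i, ω i)),
    ∀ w, φ (v w) ∈ dn (gr k (∑ i, ω i)) 0 ↔ w ∈ dn (gr k (∑ i, ω i)) 0 := by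
  have hA := p.lieGr
  have hdisj : ∀ v ∈ up (gr k (∑ i, ω i)) 1, φ v ∈ dn (gr k (∑ i, ω i)) 0 → v = 0 := by
    intro v hv hφv
    exact p.up0_dn hφ hc hx (up_mono (by omega) hv) (p.nil_dn hφv (Au.nilp hφ (hA.nilp hv)))
  let B : Submodule k g := (dn (gr k (∑ i, ω i)) 0).map (φ.symm : g →ₗ[k] g)
  have hB : ∀ w, w ∈ B ↔ φ w ∈ dn (gr k (∑ i, ω i)) 0 := by
    intro w
    constructor
    · rintro ⟨u, hu, rfl⟩
      simpa using hu
    · intro h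
      exact ⟨φ w, h, by simp⟩
  have hBd : finrank k B = finrank k (dn (gr k (∑ i, ω i)) 0) := LinearEquiv.finrank_map_eq φ.symm _
  have hBtop : B ⊔ up (gr k (∑ i, ω i)) 1 = ⊤ := by
    apply Submodule.eq_top_of_disjoint
    · rw [hBd]
      have := Submodule.finrank_add_eq_of_isCompl (hA.isCompl 0)
      rw [zero_add] at this
      omega
    · rw [Submodule.disjoint_def]
      intro v h1 h2
      exact hdisj v h2 ((hB v).mp h1)
  have hh : (∑ i, ω i) ∈ B ⊔ up (gr k (∑ i, ω i)) 1 := by rw [hBtop]; trivial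
  obtain ⟨b, hb, n, hn, e⟩ := Submodule.mem_sup.mp hh
  obtain ⟨v, hv, hvh⟩ := exists_conj hA (y := ∑ i, ω i) (h_mem ω) (by
    intro j hj r hr
    have hj0 : (j : k) ≠ 0 := by
      rw [Int.cast_ne_zero]; omega
    refine ⟨(j : k)⁻¹ • r, Submodule.smul_mem _ _ hr, ?_⟩
    rw [lie_smul, mem_gr.mp hr, smul_smul, inv_mul_cancel₀ hj0, one_smul]) (neg_mem hn)
  refine ⟨v, hv, ?_⟩
  have hvb : v (∑ i, ω i) = b := by rw [hvh, ← e]; abel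
  let ψ := φ * v
  have hψ : ψ ∈ Au k g := mul_mem hφ hv.1
  let B' : Submodule k g := (dn (gr k (∑ i, ω i)) 0).map (ψ.symm : g →ₗ[k] g)
  have hB' : ∀ w, w ∈ B' ↔ ψ w ∈ dn (gr k (∑ i, ω i)) 0 := by
    intro w
    constructor
    · rintro ⟨u, hu, rfl⟩
      simpa using hu
    · intro h
      exact ⟨ψ w, h, by simp⟩
  have hB'd : finrank k B' = finrank k (dn (gr k (∑ i, ω i)) 0) :=
    LinearEquiv.finrank_map_eq ψ.symm _
  have hh' : ψ (∑ i, ω i) ∈ dn (gr k (∑ i, ω i)) 0 := by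
    change φ (v _) ∈ _
    rw [hvb]
    exact (hB b).mp hb
  have hstab : ∀ w ∈ B', LieAlgebra.ad k g (∑ i, ω i) w ∈ B' := by
    intro w hw
    rw [hB'] at hw ⊢
    rw [LieAlgebra.ad_apply, hψ]
    exact hA.lie_dn (by omega) hh' hw
  have hle : B' ≤ dn (gr k (∑ i, ω i)) 0 := by
    have h1 := Submodule.inf_iSup_genEigenspace (p := B')
      (f := LieAlgebra.ad k g (∑ i, ω i)) hstab 1
    have h2 : (⨆ μ : k, ((LieAlgebra.ad k g (∑ i, ω i)).genEigenspace μ) 1) = ⊤ := by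
      rw [eq_top_iff, ← hA.top]
      exact iSup_le fun j => le_iSup_of_le (j : k) le_rfl
    rw [h2, inf_top_eq] at h1
    rw [h1]
    refine iSup_le fun μ => ?_
    by_cases hμ : ∃ j : ℤ, (j : k) = μ
    · obtain ⟨j, rfl⟩ := hμ
      rintro w ⟨hw1, hw2⟩
      have hw2 : w ∈ gr k (∑ i, ω i) j := hw2
      rcases le_or_gt j 0 with hj | hj
      · exact mem_dn hj hw2
      · have h3 := hdisj (v w) (Un.map_up hv (mem_up (by omega) hw2)) ((hB' w).mp hw1)
        have : w = 0 := by
          apply v.injective; rw [h3]; simp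
        rw [this]; exact zero_mem _
    · push Not at hμ
      have := p.eig_bot hμ
      change B' ⊓ Module.End.eigenspace (LieAlgebra.ad k g (∑ i, ω i)) μ ≤ _
      rw [this]
      simp
  have heq := Submodule.eq_of_le_of_finrank_eq hle hB'd
  intro w
  rw [← heq]
  exact ⟨fun h => (hB' w).mpr (by rw [← heq]; exact h), fun h => by
    have := (hB' w).mp h
    rw [← heq] at this
    exact this⟩

lemma inj_f_up (p : PF k x ω E F) {r : g} (hr : r ∈ up (gr k (∑ i, ω i)) 1)
    (h : ⁅F, r⁆ = 0) : r = 0 := by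
  have hA := p.lieGr
  have key : ∀ n : ℕ, r ∈ up (gr k (∑ i, ω i)) (n + 1) := by
    intro n
    induction n with
    | zero => simpa using hr
    | succ n ih =>
      obtain ⟨a, ha, b, hb, e⟩ := split_up ih
      have h1 := hA.lie _ _ _ _ p.F_mem' ha
      have h2 : ⁅F, b⁆ ∈ up (gr k (∑ i, ω i)) (n + 1) :=
        hA.lie_up (by omega) (mem_up le_rfl p.F_mem') hb
      have h3 : ⁅F, a⁆ = 0 := by
        refine hA.up_dn (i := n) (j := n + 1) (by omega) ?_ (mem_dn (by omega) h1)
        have : ⁅F, a⁆ = -⁅F, b⁆ := by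
          rw [eq_neg_iff_add_eq_zero, ← lie_add, ← e, h]
        rw [this]; exact neg_mem h2
      have : a = 0 := p.inj_f (by omega) ha h3
      rw [e, this, zero_add]
      push_cast; exact hb
  obtain ⟨N, hN⟩ := hA.exists_bound
  have := key N
  rw [LieGr.up_bot hN] at this
  simpa using this

lemma un_fix (p : PF k x ω E F) {s : g ≃ₗ[k] g} (hs : s ∈ Un (gr k (∑ i, ω i))) (hx : s x = x) :
    s = 1 := by
  have hA := p.lieGr
  have h0 : ∀ y ∈ wt k ω 0, s y = y := by
    intro y hy
    have h1 : s y ∈ wt k ω 0 := by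
      rw [p.zx] at hy ⊢
      rw [← hx, ← hs.1, hy, map_zero]
    rw [← p.gr_zero] at hy h1
    have := hs.2 0 y (mem_up le_rfl hy)
    exact sub_eq_zero.mp (hA.up_dn (by omega) this (mem_dn le_rfl (sub_mem h1 hy)))
  refine p.ext fun μ v hv => ?_
  have h1 : s v ∈ wt k ω μ := by
    rw [mem_wt] at hv ⊢
    intro i
    have := hs.1 (ω i) v
    rw [hv, h0 _ (p.ω_mem i), map_smul] at this
    exact this.symm
  have := hs.2 _ v (mem_up le_rfl (wt_le ω μ hv))
  exact sub_eq_zero.mp (hA.up_dn (by omega) this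
    (mem_dn le_rfl (sub_mem (wt_le ω μ h1) (wt_le ω μ hv))))

lemma dn_xe (p : PF k x ω E F) {z : g} (hz : z ∈ dn (gr k (∑ i, ω i)) 0)
    (h : ⁅z, x + ∑ i, E i⁆ ∈ dn (gr k (∑ i, ω i)) 0) : z ∈ dn (gr k (∑ i, ω i)) (-1) := by
  have hA := p.lieGr
  obtain ⟨a, ha, b, hb, e⟩ := split_dn hz
  have h1 : ⁅a, ∑ i, E i⁆ = 0 := by
    have h2 := hA.lie _ _ _ _ ha p.e_mem
    refine hA.up_dn (i := 0) (j := 1) (by omega) (mem_up (by omega) h2) ?_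
    have e1 : ⁅a, ∑ i, E i⁆ = ⁅z, x + ∑ i, E i⁆ - ⁅b, x + ∑ i, E i⁆ - ⁅a, x⁆ := by
      rw [e, add_lie, lie_add a]; abel
    rw [e1]
    refine sub_mem (sub_mem h (hA.lie_dn (by omega) hb p.xe_dn)) ?_
    exact hA.lie_dn (by omega) (mem_dn le_rfl ha) (mem_dn le_rfl p.x_gr)
  have := p.inj0 (by rw [← p.gr_zero]; exact ha) h1
  rw [e, this, zero_add]
  exact hb

lemma isD_inv (p : PF k x ω E F) {c : ι → kˣ} {τ : g ≃ₗ[k] g} (hτ : IsD ω c τ) :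
    IsD ω c⁻¹ τ⁻¹ := by
  refine ⟨inv_mem hτ.1, fun μ v hv => ?_⟩
  apply τ.injective
  rw [app_inv, map_smul, hτ.2 μ v hv, smul_smul, ← Units.val_mul]
  simp [chr]

lemma main_claim (p : PF k x ω E F) {φ u0 : g ≃ₗ[k] g} (hφ : φ ∈ Au k g)
    (hu0 : u0 ∈ Un (gr k (∑ i, ω i))) (hu0x : u0 x = x + ∑ i, E i) {c : k} (hc : c ≠ 0)
    (hx : φ x = c • (x + ∑ i, E i)) :
    ∃ c' : ι → kˣ, ∀ τ, IsD ω c' τ → ∀ w ∈ dn (gr k (∑ i, ω i)) 0,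
      φ (τ (u0⁻¹ w)) ∈ dn (gr k (∑ i, ω i)) 0 := by
  have hA := p.lieGr
  obtain ⟨v, hv, hψ0⟩ := p.exists_v hφ hc hx
  have hψ : φ * v ∈ Au k g := mul_mem hφ hv.1
  have hψ1 : ∀ w, φ (v w) ∈ dn (gr k (∑ i, ω i)) (-1) ↔ w ∈ dn (gr k (∑ i, ω i)) (-1) := by
    intro w
    constructor
    · intro h
      refine p.nil_dn ((hψ0 w).mp (dn_mono (by omega) h)) ?_
      exact (Au.nilp_iff hψ).mp (hA.nilp_dn h)
    · intro h
      refine p.nil_dn ((hψ0 w).mpr (dn_mono (by omega) h)) ?_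
      exact Au.nilp hψ (hA.nilp_dn h)
  have hlie : ∀ z, φ (v ⁅z, v⁻¹ x⁆) = c • ⁅φ (v z), x + ∑ i, E i⁆ := by
    intro z
    rw [hv.1, app_inv, hφ, hx, lie_smul]
  have hvi : v⁻¹ ∈ Un (gr k (∑ i, ω i)) := inv_mem hv
  have hq := hvi.2 0 x (mem_up le_rfl p.x_gr)
  rw [zero_add] at hq
  obtain ⟨e', he', r, hr, eq⟩ := split_up hq
  have hF : ⁅F, v⁻¹ x⁆ ∈ dn (gr k (∑ i, ω i)) 0 := by
    rw [← hψ0, hlie]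
    refine Submodule.smul_mem _ _ (hA.lie_dn (i := -1) (by omega) ?_ p.xe_dn)
    rw [hψ1]
    exact mem_dn le_rfl p.F_mem'
  have hr0 : r = 0 := by
    refine p.inj_f_up (up_mono (by omega) hr) ?_
    refine hA.up_dn (i := 0) (j := 1) (by omega)
      (hA.lie_up (by omega) (mem_up le_rfl p.F_mem') hr) ?_
    have e1 : ⁅F, r⁆ = ⁅F, v⁻¹ x⁆ - ⁅F, x⁆ - ⁅F, e'⁆ := by
      rw [← lie_sub, eq, lie_add]; abel
    rw [e1]
    refine sub_mem (sub_mem hF ?_) ?_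
    · exact hA.lie_dn (by omega) (mem_dn le_rfl p.F_mem') (mem_dn le_rfl p.x_gr)
    · exact hA.lie_dn (by omega) (mem_dn le_rfl p.F_mem') (mem_dn le_rfl he')
  obtain ⟨d, hd⟩ := p.gr_one he'
  have hvx : v⁻¹ x = x + ∑ i, d i • E i := by
    rw [← hd]; rw [hr0, add_zero] at eq; rw [← eq]; abel
  have hd0 : ∀ i, d i ≠ 0 := by
    intro i hi
    have h1 : ⁅ω i, v⁻¹ x⁆ = 0 := by
      rw [hvx, lie_add, p.ab (p.ω_mem i) p.x_mem, zero_add, lie_sum]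
      refine Finset.sum_eq_zero fun j _ => ?_
      rw [lie_smul, p.lie_ωE]
      split_ifs with h
      · rw [← h, hi, zero_smul]
      · simp
    have h2 := hlie (ω i)
    rw [h1, map_zero, map_zero, eq_comm, smul_eq_zero] at h2
    have h2 := h2.resolve_left hc
    have hω : ω i ∈ gr k (∑ i, ω i) 0 := by rw [p.gr_zero]; exact p.ω_mem i
    have h3 := p.dn_xe ((hψ0 _).mpr (mem_dn le_rfl hω)) (by rw [h2]; exact zero_mem _)
    rw [hψ1] at h3
    have h4 := hA.up_dn (i := -1) (j := 0) (by omega) (mem_up le_rfl hω) h3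
    have h5 := p.lie_ωE i i
    rw [h4, zero_lie, if_pos rfl] at h5
    exact p.E_ne i h5.symm
  refine ⟨fun i => Units.mk0 (d i) (hd0 i), fun τ hτ w hw => ?_⟩
  have hτi := p.isD_inv hτ
  have hτx : τ x = x := by
    rw [hτ.2 0 x p.x_mem, chr_zero]; simp
  have hτix : τ⁻¹ x = x := by rw [← hτx, inv_app, hτx]
  have hτe : τ (∑ i, E i) = ∑ i, d i • E i := by
    rw [map_sum]
    refine Finset.sum_congr rfl fun i _ => ?_
    rw [hτ.2 _ _ (p.E_mem i), chr_single]; rfl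
  have hun : τ * u0 * τ⁻¹ ∈ Un (gr k (∑ i, ω i)) := by
    refine ⟨mul_mem (mul_mem hτ.1 hu0.1) hτi.1, fun j y hy => ?_⟩
    have h1 := hu0.2 j _ (p.isD_part hτi hy)
    have h2 := p.isD_part hτ h1
    rw [map_sub, app_inv] at h2
    exact h2
  have hs : v * (τ * u0 * τ⁻¹) = 1 := by
    refine p.un_fix (mul_mem hv hun) ?_
    simp only [LinearEquiv.mul_apply]
    rw [hτix, hu0x, map_add, hτx, hτe, ← hvx, app_inv]
  have hv2 : v = τ * u0⁻¹ * τ⁻¹ := by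
    rw [mul_eq_one_iff_eq_inv] at hs
    rw [hs]; group
  have : φ (τ (u0⁻¹ w)) = φ (v (τ w)) := by
    rw [hv2]
    simp only [LinearEquiv.mul_apply]
    rw [inv_app]
  rw [this, hψ0]
  exact p.isD_part hτ hw

lemma exists_u0 (p : PF k x ω E F) : ∃ u0 ∈ Un (gr k (∑ i, ω i)), u0 x = x + ∑ i, E i :=
  exists_conj p.lieGr p.x_gr (fun j hj r hr => p.x_surj (by omega) hr) (mem_up le_rfl p.e_mem)

end PF
end PNR
end PNR

section PNR
set_option linter.unusedSectionVars false
variable {k : Type*} [Field k] [CharZero k]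
variable {g : Type*} [LieRing g] [LieAlgebra k g] [FiniteDimensional k g]

namespace PNR
variable {ι : Type*} [Fintype ι] [DecidableEq ι]

lemma sum_pow_fix {s : g ≃ₗ[k] g} {m : ℕ} (hs : s ^ m = 1) (y : g) :
    s (∑ i ∈ Finset.range m, (s ^ i) y) = ∑ i ∈ Finset.range m, (s ^ i) y := by
  have h1 := Finset.sum_range_succ (fun i => (s ^ i) y) m
  have h2 := Finset.sum_range_succ' (fun i => (s ^ i) y) m
  rw [h1, hs] at h2
  simp only [pow_zero] at h2
  rw [map_sum, add_right_cancel h2]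
  refine Finset.sum_congr rfl fun i _ => ?_
  rw [pow_succ', LinearEquiv.mul_apply]

namespace PF
variable {x : g} {ω E : ι → g} {F : g}

/-- automorphisms fixing the Cartan subalgebra pointwise -/
def TT (k : Type*) [Field k] {g : Type*} [LieRing g] [LieAlgebra k g] {ι : Type*}
    (ω : ι → g) : Subgroup (g ≃ₗ[k] g) where
  carrier := {s | s ∈ Au k g ∧ ∀ y ∈ wt k ω 0, s y = y}
  one_mem' := ⟨one_mem _, fun _ _ => rfl⟩
  mul_mem' := by
    rintro a b ⟨ha, ha'⟩ ⟨hb, hb'⟩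
    exact ⟨mul_mem ha hb, fun y hy => by rw [LinearEquiv.mul_apply, hb' y hy, ha' y hy]⟩
  inv_mem' := by
    rintro a ⟨ha, ha'⟩
    refine ⟨inv_mem ha, fun y hy => ?_⟩
    apply a.injective
    rw [← LinearEquiv.mul_apply, mul_inv_cancel, ha' y hy]; rfl

lemma isD_TT {c : ι → kˣ} {s : g ≃ₗ[k] g} (hs : IsD ω c s) : s ∈ TT k ω :=
  ⟨hs.1, fun y hy => by rw [hs.2 0 y hy, chr_zero]; simp⟩

lemma TT_wt (p : PF k x ω E F) {s : g ≃ₗ[k] g} (hs : s ∈ TT k ω) {μ : ι → ℤ} {v : g}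
    (hv : v ∈ wt k ω μ) : s v ∈ wt k ω μ := by
  rw [mem_wt] at hv ⊢
  intro i
  have := hs.1 (ω i) v
  rw [hv, hs.2 _ (p.ω_mem i), map_smul] at this
  exact this.symm

lemma TT_comm (p : PF k x ω E F) {s t : g ≃ₗ[k] g} (hs : s ∈ TT k ω) (ht : t ∈ TT k ω) :
    s * t = t * s := by
  refine p.ext fun μ v hv => ?_
  rw [LinearEquiv.mul_apply, LinearEquiv.mul_apply]
  by_cases hμ : μ = 0
  · subst hμ
    rw [hs.2 v hv, ht.2 v hv, hs.2 v hv]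
  by_cases hv0 : v = 0
  · simp [hv0]
  obtain ⟨a, ha⟩ := p.wt_line hμ hv hv0 (p.TT_wt hs hv)
  obtain ⟨b, hb⟩ := p.wt_line hμ hv hv0 (p.TT_wt ht hv)
  rw [ha, hb, map_smul, map_smul, ha, hb, smul_smul, smul_smul, mul_comm]

lemma joint (p : PF k x ω E F) {w : g} (hw : w ≠ 0) (h : ∀ i, ∃ b : k, ⁅ω i, w⁆ = b • w) :
    ∃ ν, w ∈ wt k ω ν := by
  have : ∀ i, ∃ n : ℤ, ⁅ω i, w⁆ = (n : k) • w := by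
    intro i
    obtain ⟨b, hb⟩ := h i
    by_cases hn : ∃ n : ℤ, (n : k) = b
    · obtain ⟨n, rfl⟩ := hn
      exact ⟨n, hb⟩
    · exfalso
      push Not at hn
      have h := (Module.End.eigenspaces_iSupIndep (LieAlgebra.ad k g (ω i))) b
      have h2 : (⨆ (j) (_ : j ≠ b), Module.End.eigenspace (LieAlgebra.ad k g (ω i)) j) = ⊤ := by
        rw [eq_top_iff, ← p.top]
        exact iSup_le fun μ => le_iSup₂_of_le (μ i : k) (hn (μ i)) (iInf_le _ i)
      rw [h2] at h
      have h3 := disjoint_top.mp h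
      have : w ∈ Module.End.eigenspace (LieAlgebra.ad k g (ω i)) b := by
        rw [Module.End.mem_eigenspace_iff]; exact hb
      rw [h3] at this
      exact hw (by simpa using this)
  choose ν hν using this
  exact ⟨ν, mem_wt.mpr hν⟩

/-- scalar action on weight spaces -/
lemma scal (p : PF k x ω E F) {μ : ι → ℤ} {v y : g} (hv : v ∈ wt k ω μ) (hy : y ∈ wt k ω 0) :
    ∃ b : k, ⁅y, v⁆ = b • v := by
  obtain ⟨a, rfl⟩ := (Submodule.mem_span_range_iff_exists_fun k).mp (p.span hy)
  rw [mem_wt] at hv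
  refine ⟨∑ i, a i * μ i, ?_⟩
  rw [sum_lie, Finset.sum_smul]
  refine Finset.sum_congr rfl fun i _ => ?_
  rw [smul_lie, hv, smul_smul]

section theta
variable {θ : g ≃ₗ[k] g} {m : ℕ} {ζ : k}

lemma θ_wt0 (p : PF k x ω E F) (hθ : θ ∈ Au k g) (hζ : ζ ≠ 0) (hx : θ x = ζ • x) {y : g}
    (hy : y ∈ wt k ω 0) : θ y ∈ wt k ω 0 := by
  rw [p.zx] at hy ⊢
  have := hθ x y
  rw [hy, hx, smul_lie, map_zero, eq_comm, smul_eq_zero] at this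
  exact this.resolve_left hζ

lemma inv_x (hζ : ζ ≠ 0) (hx : θ x = ζ • x) : θ⁻¹ x = ζ⁻¹ • x := by
  apply θ.injective
  rw [app_inv, map_smul, hx, smul_smul, inv_mul_cancel₀ hζ, one_smul]

lemma θ_wt (p : PF k x ω E F) (hθ : θ ∈ Au k g) (hζ : ζ ≠ 0) (hx : θ x = ζ • x) {μ : ι → ℤ}
    {v : g} (hv0 : v ≠ 0) (hv : v ∈ wt k ω μ) : ∃ ν, θ v ∈ wt k ω ν := by
  refine p.joint (by simpa using hv0) fun i => ?_
  obtain ⟨b, hb⟩ := p.scal hv (p.θ_wt0 (inv_mem hθ) (inv_ne_zero hζ) (inv_x hζ hx) (p.ω_mem i))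
  refine ⟨b, ?_⟩
  rw [← map_smul, ← hb, hθ, app_inv]

lemma θ_pow_wt (p : PF k x ω E F) (hθ : θ ∈ Au k g) (hζ : ζ ≠ 0) (hx : θ x = ζ • x) {μ : ι → ℤ}
    {v : g} (hv0 : v ≠ 0) (hv : v ∈ wt k ω μ) (n : ℕ) : ∃ ν, (θ ^ n) v ∈ wt k ω ν := by
  induction n with
  | zero => exact ⟨μ, by simpa using hv⟩
  | succ n ih =>
    obtain ⟨ν, hν⟩ := ih
    rw [pow_succ', LinearEquiv.mul_apply]
    exact p.θ_wt hθ hζ hx (by simpa using hv0) hν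

lemma twist (p : PF k x ω E F) (hθ : θ ∈ Au k g) (hζ : ζ ≠ 0) (hx : θ x = ζ • x)
    (hθm : θ ^ m = 1) (hLF : ∀ y, θ y = y → ⁅x, y⁆ = 0 → y = 0)
    {a : ι → kˣ} {α : g ≃ₗ[k] g} (hα : IsD ω a α) : (α * θ) ^ m = 1 := by
  refine p.ext fun μ v hv => ?_
  by_cases hv0 : v = 0
  · simp [hv0]
  choose ν hν using p.θ_pow_wt hθ hζ hx hv0 hv
  have h1 : ∀ n : ℕ, ((α * θ) ^ n) v =
      ((∏ i ∈ Finset.range n, chr a (ν (i + 1)) : kˣ) : k) • (θ ^ n) v := by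
    intro n
    induction n with
    | zero => simp
    | succ n ih =>
      rw [pow_succ', LinearEquiv.mul_apply, ih, map_smul, LinearEquiv.mul_apply,
        ← LinearEquiv.mul_apply θ, ← pow_succ', hα.2 _ _ (hν (n + 1)), smul_smul,
        Finset.prod_range_succ, Units.val_mul]
  have h2 : ∑ i ∈ Finset.range m, ν (i + 1) = 0 := by
    ext j
    have hθi : θ⁻¹ ^ m = 1 := by rw [inv_pow, hθm, inv_one]
    have hY := sum_pow_fix hθi (θ⁻¹ (ω j))
    have hY0 : ∀ n : ℕ, (θ⁻¹ ^ n) (θ⁻¹ (ω j)) ∈ wt k ω 0 := by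
      intro n
      have hs : ∀ y ∈ wt k ω 0, θ⁻¹ y ∈ wt k ω 0 := fun y hy =>
        p.θ_wt0 (inv_mem hθ) (inv_ne_zero hζ) (inv_x hζ hx) hy
      induction n with
      | zero => simpa using hs _ (p.ω_mem j)
      | succ n ih => rw [pow_succ', LinearEquiv.mul_apply]; exact hs _ ih
    have hz := hLF (∑ i ∈ Finset.range m, (θ⁻¹ ^ i) (θ⁻¹ (ω j)))
      (by nth_rewrite 1 [← hY]; rw [app_inv])
      ((p.zx _).mp (sum_mem fun i _ => hY0 i))
    have h3 : ∀ i : ℕ, ⁅(θ⁻¹ ^ i) (θ⁻¹ (ω j)), v⁆ = (ν (i + 1) j : k) • v := by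
      intro i
      have h4 := mem_wt.mp (hν (i + 1)) j
      apply (θ ^ (i + 1)).injective
      have h5 := pow_mem hθ (i + 1)
      rw [h5, map_smul, ← h4, ← LinearEquiv.mul_apply (θ⁻¹ ^ i), ← pow_succ, inv_pow, app_inv]
    have h4 : ((∑ i ∈ Finset.range m, ν (i + 1) j : ℤ) : k) • v = 0 := by
      push_cast
      rw [Finset.sum_smul, ← Finset.sum_congr rfl fun i _ => h3 i, ← sum_lie, hz, zero_lie]
    rw [smul_eq_zero] at h4
    have h5 := h4.resolve_right hv0
    rw [Int.cast_eq_zero] at h5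
    simpa using h5
  rw [h1 m, ← chr_sum, h2, chr_zero, hθm]
  simp

lemma exists_t (p : PF k x ω E F) (hθ : θ ∈ Au k g) (hζ : ζ ≠ 0) (hx : θ x = ζ • x)
    {α : g ≃ₗ[k] g} (hα : α ∈ TT k ω) (hm : (α * θ) ^ m = 1) (hθm : θ ^ m = 1) :
    ∃ t ∈ TT k ω, α ^ m * (θ * t * θ⁻¹) = t := by
  have hconj : ∀ t ∈ TT k ω, θ * t * θ⁻¹ ∈ TT k ω := by
    intro t ht
    refine ⟨mul_mem (mul_mem hθ ht.1) (inv_mem hθ), fun y hy => ?_⟩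
    rw [LinearEquiv.mul_apply, LinearEquiv.mul_apply,
      ht.2 _ (p.θ_wt0 (inv_mem hθ) (inv_ne_zero hζ) (inv_x hζ hx) hy), app_inv]
  have hp : ∀ n : ℕ, (α * θ) ^ n * (θ ^ n)⁻¹ ∈ TT k ω := by
    intro n
    induction n with
    | zero => simp
    | succ n ih =>
      have : (α * θ) ^ (n + 1) * (θ ^ (n + 1))⁻¹ =
          α * (θ * ((α * θ) ^ n * (θ ^ n)⁻¹) * θ⁻¹) := by
        rw [pow_succ', pow_succ']; group
      rw [this]
      exact mul_mem hα (hconj _ ih)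
  have key : ∀ n : ℕ, ∃ t ∈ TT k ω,
      α ^ n * (θ * t * θ⁻¹) = t * ((α * θ) ^ n * (θ ^ n)⁻¹) := by
    intro n
    induction n with
    | zero => exact ⟨1, one_mem _, by simp⟩
    | succ n ih =>
      obtain ⟨t, ht, e⟩ := ih
      set P := (α * θ) ^ n * (θ ^ n)⁻¹ with hP
      have hPn := hp n
      have e1 : (α * θ) ^ (n + 1) * (θ ^ (n + 1))⁻¹ = α * (θ * P * θ⁻¹) := by
        rw [hP, pow_succ', pow_succ']; group
      refine ⟨t * P, mul_mem ht hPn, ?_⟩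
      rw [e1]
      have e2 : θ * (t * P) * θ⁻¹ = (θ * t * θ⁻¹) * (θ * P * θ⁻¹) := by group
      rw [e2, pow_succ', mul_assoc, ← mul_assoc (α ^ n), e, ← mul_assoc, ← mul_assoc,
        p.TT_comm hα (mul_mem ht hPn)]
      simp only [hP, mul_assoc]
  obtain ⟨t, ht, e⟩ := key m
  refine ⟨t, ht, ?_⟩
  rw [e, hm, hθm]; simp

end theta
end PF
end PNR
end PNR

section PNR
set_option linter.unusedSectionVars false
variable {k : Type*} [Field k] [CharZero k]
variable {g : Type*} [LieRing g] [LieAlgebra k g] [FiniteDimensional k g]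

namespace PNR
variable {ι : Type*} [Fintype ι] [DecidableEq ι]

namespace PF
variable {x : g} {ω E : ι → g} {F : g}

lemma step6 (p : PF k x ω E F) {ψ : g ≃ₗ[k] g} (hψ : ψ ∈ Au k g) {m : ℕ} (hm : 1 ≤ m)
    (hψm : ψ ^ m = 1) {ζ : k} (hζ : ζ ≠ 0)
    (hx : ψ (x + ∑ i, E i) = ζ⁻¹ • (x + ∑ i, E i))
    (h0 : ∀ w ∈ dn (gr k (∑ i, ω i)) 0, ψ w ∈ dn (gr k (∑ i, ω i)) 0) :
    ∃ v ∈ Au k g, ψ (v (∑ i, E i)) = ζ⁻¹ • v (∑ i, E i) := by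
  have hA := p.lieGr
  have h1 : ∀ w ∈ dn (gr k (∑ i, ω i)) (-1), ψ w ∈ dn (gr k (∑ i, ω i)) (-1) := by
    intro w hw
    exact p.nil_dn (h0 w (dn_mono (by omega) hw)) (Au.nilp hψ (hA.nilp_dn hw))
  have hhx : ⁅∑ i, ω i, x + ∑ i, E i⁆ = ∑ i, E i := by
    rw [lie_add, mem_gr.mp p.x_gr, mem_gr.mp p.e_mem]; simp
  have hh : ψ (∑ i, ω i) - ∑ i, ω i ∈ dn (gr k (∑ i, ω i)) (-1) := by
    have hh0 : ∑ i, ω i ∈ dn (gr k (∑ i, ω i)) 0 := mem_dn le_rfl (h_mem ω)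
    refine p.dn_xe (sub_mem (h0 _ hh0) hh0) ?_
    have e1 := hψ (∑ i, ω i) (x + ∑ i, E i)
    rw [hhx, hx, lie_smul] at e1
    have e2 : ⁅ψ (∑ i, ω i), x + ∑ i, E i⁆ = ζ • ψ (∑ i, E i) := by
      rw [e1, smul_smul, mul_inv_cancel₀ hζ, one_smul]
    have e3 : ψ (∑ i, E i) = ζ⁻¹ • (x + ∑ i, E i) - ψ x := by
      rw [← hx, map_add]; abel
    have hx0 : x ∈ dn (gr k (∑ i, ω i)) 0 := mem_dn le_rfl p.x_gr
    have e4 : ⁅ψ (∑ i, ω i) - ∑ i, ω i, x + ∑ i, E i⁆ = x - ζ • ψ x := by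
      rw [sub_lie, e2, hhx, e3, smul_sub, smul_smul, mul_inv_cancel₀ hζ, one_smul]; abel
    rw [e4]
    exact sub_mem hx0 (Submodule.smul_mem _ _ (h0 _ hx0))
  have hhn : ∀ n : ℕ, (ψ ^ n) (∑ i, ω i) - ∑ i, ω i ∈ dn (gr k (∑ i, ω i)) (-1) := by
    intro n
    induction n with
    | zero => simp
    | succ n ih =>
      rw [pow_succ', LinearEquiv.mul_apply]
      have := add_mem (h1 _ ih) hh
      rw [map_sub] at this
      simpa using this
  have hmk : (m : k) ≠ 0 := by rw [Nat.cast_ne_zero]; omega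
  let h' := (m : k)⁻¹ • ∑ n ∈ Finset.range m, (ψ ^ n) (∑ i, ω i)
  have hfix : ψ h' = h' := by
    simp only [h', map_smul]
    rw [sum_pow_fix hψm]
  have hd : h' - ∑ i, ω i ∈ dn (gr k (∑ i, ω i)) (-1) := by
    have : h' - ∑ i, ω i = (m : k)⁻¹ • ∑ n ∈ Finset.range m, ((ψ ^ n) (∑ i, ω i) - ∑ i, ω i) := by
      rw [Finset.sum_sub_distrib, smul_sub, Finset.sum_const, Finset.card_range,
        ← Nat.cast_smul_eq_nsmul k, smul_smul, inv_mul_cancel₀ hmk, one_smul]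
    rw [this]
    exact Submodule.smul_mem _ _ (sum_mem fun n _ => hhn n)
  rw [← up_neg] at hd
  obtain ⟨v, hv, hvh⟩ := exists_conj hA.neg (y := ∑ i, ω i) (h_mem ω) (by
    intro j hj r hr
    have hj0 : ((-j : ℤ) : k) ≠ 0 := by
      rw [Int.cast_ne_zero]; omega
    refine ⟨((-j : ℤ) : k)⁻¹ • r, Submodule.smul_mem _ _ hr, ?_⟩
    rw [lie_smul, mem_gr.mp hr, smul_smul, inv_mul_cancel₀ hj0, one_smul]) hd
  rw [add_sub_cancel] at hvh
  refine ⟨v, hv.1, ?_⟩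
  let s := v⁻¹ * ψ * v
  have hs : s ∈ Au k g := mul_mem (mul_mem (inv_mem hv.1) hψ) hv.1
  have hsh : s (∑ i, ω i) = ∑ i, ω i := by
    simp only [s, LinearEquiv.mul_apply]
    rw [hvh, hfix, ← hvh, inv_app]
  have hsA : ∀ j, ∀ w ∈ gr k (∑ i, ω i) j, s w ∈ gr k (∑ i, ω i) j := by
    intro j w hw
    rw [mem_gr] at hw ⊢
    have := hs (∑ i, ω i) w
    rw [hw, hsh, map_smul] at this
    exact this.symm
  have hsdn : ∀ w ∈ dn (gr k (∑ i, ω i)) 0, s w ∈ dn (gr k (∑ i, ω i)) 0 := by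
    intro w hw
    have : dn (gr k (∑ i, ω i)) 0 ≤ (dn (gr k (∑ i, ω i)) 0).comap (s : g →ₗ[k] g) :=
      part_le fun j hj w hw => mem_part hj (hsA j w hw)
    exact this hw
  have hw1 : v⁻¹ (x + ∑ i, E i) - (x + ∑ i, E i) ∈ dn (gr k (∑ i, ω i)) 0 := by
    have hvi := inv_mem hv
    have := hvi.2 (-1) (x + ∑ i, E i) (by rw [up_neg]; exact p.xe_dn)
    rw [up_neg] at this
    simpa using this
  have hw2 : v⁻¹ (x + ∑ i, E i) - ∑ i, E i ∈ dn (gr k (∑ i, ω i)) 0 := by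
    have := add_mem hw1 (mem_dn (j := 0) le_rfl p.x_gr)
    have e : v⁻¹ (x + ∑ i, E i) - (x + ∑ i, E i) + x = v⁻¹ (x + ∑ i, E i) - ∑ i, E i := by abel
    rwa [e] at this
  have hsw : s (v⁻¹ (x + ∑ i, E i)) = ζ⁻¹ • v⁻¹ (x + ∑ i, E i) := by
    simp only [s, LinearEquiv.mul_apply]
    rw [app_inv, hx, map_smul]
  have hse : s (∑ i, E i) - ζ⁻¹ • ∑ i, E i = 0 := by
    refine hA.up_dn (i := 0) (j := 1) (by omega)
      (mem_up le_rfl (sub_mem (hsA 1 _ p.e_mem) (Submodule.smul_mem _ _ p.e_mem))) ?_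
    have e : s (∑ i, E i) - ζ⁻¹ • ∑ i, E i = ζ⁻¹ • (v⁻¹ (x + ∑ i, E i) - ∑ i, E i)
        - s (v⁻¹ (x + ∑ i, E i) - ∑ i, E i) := by
      rw [map_sub, hsw, smul_sub]; abel
    rw [e]
    exact sub_mem (Submodule.smul_mem _ _ hw2) (hsdn _ hw2)
  have hse := sub_eq_zero.mp hse
  rw [← map_smul, ← hse]
  simp only [s, LinearEquiv.mul_apply]
  rw [app_inv]

lemma ker_e (p : PF k x ω E F) {v : g} (h : ⁅∑ i, E i, v⁆ = 0) :
    v ∈ up (gr k (∑ i, ω i)) 1 := by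
  have hA := p.lieGr
  obtain ⟨N, hN⟩ := hA.exists_bound
  have key : ∀ n : ℕ, n ≤ N + 1 → v ∈ up (gr k (∑ i, ω i)) (-N + n) := by
    intro n
    induction n with
    | zero => intro _; simp only [Nat.cast_zero, add_zero]; rw [hA.up_top hN]; trivial
    | succ n ih =>
      intro hn
      obtain ⟨a, ha, b, hb, e⟩ := split_up (ih (by omega))
      have h1 := hA.lie _ _ _ _ p.e_mem ha
      have h2 : ⁅∑ i, E i, b⁆ ∈ up (gr k (∑ i, ω i)) (-N + n + 2) :=
        hA.lie_up (by omega) (mem_up le_rfl p.e_mem) hb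
      have h3 : ⁅∑ i, E i, a⁆ = 0 := by
        refine hA.up_dn (i := -N + n + 1) (j := -N + n + 2) (by omega) ?_ (mem_dn (by omega) h1)
        have : ⁅∑ i, E i, a⁆ = -⁅∑ i, E i, b⁆ := by
          rw [eq_neg_iff_add_eq_zero, ← lie_add, ← e, h]
        rw [this]; exact neg_mem h2
      have ha0 : a = 0 := by
        by_cases hn0 : (-N + n : ℤ) = 0
        · rw [hn0, p.gr_zero] at ha
          refine p.inj0 ha ?_
          rw [← lie_skew, h3, neg_zero]
        · exact p.inj_e (by omega) ha h3
      rw [e, ha0, zero_add]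
      push_cast
      rw [← add_assoc]; exact hb
  have := key (N + 1) le_rfl
  simpa using this

lemma kill_orth (p : PF k x ω E F) {i j : ℤ} (hij : i + j ≠ 0) {u v : g}
    (hu : u ∈ gr k (∑ i, ω i) i) (hv : v ∈ gr k (∑ i, ω i) j) : killingForm k g u v = 0 := by
  rw [mem_gr] at hu hv
  have h := LieModule.traceForm_apply_lie_apply k g g u (∑ i, ω i) v
  rw [hv, ← lie_skew, hu, map_smul, map_neg, map_smul] at h
  have h2 : ((i + j : ℤ) : k) * killingForm k g u v = 0 := by
    simp only [LinearMap.neg_apply, LinearMap.smul_apply, smul_eq_mul] at h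
    push_cast
    rw [add_mul]
    change _ = _ * killingForm k g u v at h
    rw [← h]
    simp
  rw [mul_eq_zero, Int.cast_eq_zero] at h2
  exact h2.resolve_left hij

lemma kill_up (p : PF k x ω E F) {u v : g}
    (hu : u ∈ up (gr k (∑ i, ω i)) 1) (hv : v ∈ up (gr k (∑ i, ω i)) 0) :
    killingForm k g u v = 0 := by
  have h1 : ∀ i, 1 ≤ i → ∀ u ∈ gr k (∑ i, ω i) i, killingForm k g u v = 0 := by
    intro i hi u hu
    have : up (gr k (∑ i, ω i)) 0 ≤ LinearMap.ker (killingForm k g u) :=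
      part_le fun j hj w hw => p.kill_orth (by simp at hj; omega) hu hw
    exact this hv
  have : up (gr k (∑ i, ω i)) 1 ≤ LinearMap.ker ((killingForm k g).flip v) :=
    part_le fun j hj w hw => h1 j hj w hw
  exact this hu

lemma finrank_ker_e [LieAlgebra.IsKilling k g] (p : PF k x ω E F) :
    finrank k (LinearMap.ker (LieAlgebra.ad k g (∑ i, E i))) =
      finrank k (LinearMap.ker (LieAlgebra.ad k g x)) := by
  have hA := p.lieGr
  have hker : LinearMap.ker (LieAlgebra.ad k g x) = gr k (∑ i, ω i) 0 := by
    ext v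
    rw [p.gr_zero, p.zx]; simp
  rw [hker]
  have hrange : up (gr k (∑ i, ω i)) 0 ≤ LinearMap.range (LieAlgebra.ad k g (∑ i, E i)) := by
    have hB := LieAlgebra.IsKilling.killingForm_nondegenerate k g
    have hsymm : LinearMap.IsSymm (killingForm k g) := LieModule.traceForm_isSymm k g g
    rw [← LinearMap.BilinForm.orthogonal_orthogonal hB hsymm.isRefl
      (LinearMap.range (LieAlgebra.ad k g (∑ i, E i)))]
    intro r hr u hu
    refine p.kill_up (p.ker_e ?_) hr
    refine hB.1 _ fun w => ?_
    have h1 := hu _ ⟨w, rfl⟩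
    have h2 := LieModule.traceForm_apply_lie_apply k g g w (∑ i, E i) u
    have h3 : killingForm k g ⁅w, ∑ i, E i⁆ u = 0 := by
      have : killingForm k g ⁅∑ i, E i, w⁆ u = 0 := h1
      rw [← lie_skew, map_neg, LinearMap.neg_apply, this, neg_zero]
    have h4 : killingForm k g w ⁅∑ i, E i, u⁆ = 0 := h2.symm.trans h3
    rw [← h4]
    first | exact LieModule.traceForm_comm k g g _ _ | rfl
  let f : up (gr k (∑ i, ω i)) 0 →ₗ[k] g :=
    (LieAlgebra.ad k g (∑ i, E i) : g →ₗ[k] g) ∘ₗ (up (gr k (∑ i, ω i)) 0).subtype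
  have hf : LinearMap.range f = up (gr k (∑ i, ω i)) 1 := by
    apply le_antisymm
    · rintro _ ⟨⟨w, hw⟩, rfl⟩
      exact hA.lie_up (by omega) (mem_up le_rfl p.e_mem) hw
    · intro r hr
      obtain ⟨u, hu⟩ := hrange (up_mono (by omega) hr)
      have hut : u ∈ part (gr k (∑ i, ω i)) Set.univ := hA.mem_univ u
      obtain ⟨a, ha, b, hb, e⟩ := split (Q := Set.Iic (-1)) (R := Set.Ici 0)
        (by intro i _; simp; omega) hut
      refine ⟨⟨b, hb⟩, ?_⟩
      have hu' : ⁅∑ i, E i, u⁆ = r := hu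
      change ⁅∑ i, E i, b⁆ = r
      have h1 : ⁅∑ i, E i, a⁆ = 0 := by
        refine hA.up_dn (i := 0) (j := 1) (by omega) ?_
          (hA.lie_dn (by omega) (mem_dn le_rfl p.e_mem) ha)
        have : ⁅∑ i, E i, a⁆ = r - ⁅∑ i, E i, b⁆ := by
          rw [← hu', e, lie_add]; abel
        rw [this]
        exact sub_mem hr (hA.lie_up (by omega) (mem_up le_rfl p.e_mem) hb)
      rw [← hu', e, lie_add, h1, zero_add]
  have hkf : finrank k (LinearMap.ker f) =
      finrank k (LinearMap.ker (LieAlgebra.ad k g (∑ i, E i))) := by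
    have hle : LinearMap.ker (LieAlgebra.ad k g (∑ i, E i)) ≤ up (gr k (∑ i, ω i)) 0 := by
      intro v hv
      exact up_mono (by omega) (p.ker_e hv)
    exact (Submodule.comapSubtypeEquivOfLe hle).finrank_eq
  have h1 := LinearMap.finrank_range_add_finrank_ker f
  rw [hf, hkf] at h1
  have h2 : finrank k (up (gr k (∑ i, ω i)) 0) =
      finrank k (gr k (∑ i, ω i) 0) + finrank k (up (gr k (∑ i, ω i)) 1) := by
    have h3 := Submodule.finrank_sup_add_finrank_inf_eq (gr k (∑ i, ω i) 0)
      (up (gr k (∑ i, ω i)) 1)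
    have h4 : gr k (∑ i, ω i) 0 ⊔ up (gr k (∑ i, ω i)) 1 = up (gr k (∑ i, ω i)) 0 := by
      apply le_antisymm
      · exact sup_le (fun v hv => mem_up le_rfl hv) (fun v hv => up_mono (by omega) hv)
      · intro v hv
        obtain ⟨a, ha, b, hb, e⟩ := split_up hv
        exact Submodule.mem_sup.mpr ⟨a, ha, b, hb, e.symm⟩
    have h5 : gr k (∑ i, ω i) 0 ⊓ up (gr k (∑ i, ω i)) 1 = ⊥ := by
      rw [eq_bot_iff]
      rintro v ⟨h1, h2⟩
      have := hA.up_dn (i := 0) (by omega) h2 (mem_dn le_rfl h1)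
      simpa using this
    rw [h4, h5] at h3
    simpa using h3
  omega

lemma Au_ker {φ : g ≃ₗ[k] g} (hφ : φ ∈ Au k g) (e : g) :
    finrank k (LinearMap.ker (LieAlgebra.ad k g (φ e))) =
      finrank k (LinearMap.ker (LieAlgebra.ad k g e)) := by
  have : LinearMap.ker (LieAlgebra.ad k g (φ e)) =
      (LinearMap.ker (LieAlgebra.ad k g e)).map (φ : g →ₗ[k] g) := by
    ext v
    simp only [LinearMap.mem_ker, LieAlgebra.ad_apply, Submodule.mem_map]
    constructor
    · intro h
      refine ⟨φ⁻¹ v, ?_, app_inv φ v⟩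
      apply φ.injective
      rw [hφ, app_inv, h, map_zero]
    · rintro ⟨w, hw, rfl⟩
      change ⁅φ e, φ w⁆ = 0
      rw [← hφ, hw, map_zero]
  rw [this]
  exact LinearEquiv.finrank_map_eq φ _

theorem final [IsAlgClosed k] [LieAlgebra.IsKilling k g] (p : PF k x ω E F)
    {θ : g ≃ₗ[k] g} {m : ℕ} {ζ : k} (hm : 1 ≤ m) (hθ : θ ∈ Au k g) (hζ : ζ ≠ 0)
    (hx : θ x = ζ • x) (hθm : θ ^ m = 1) (hLF : ∀ y, θ y = y → ⁅x, y⁆ = 0 → y = 0) :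
    ∃ e, θ e = ζ • e ∧ IsNilpotent (LieAlgebra.ad k g e) ∧
      finrank k (LinearMap.ker (LieAlgebra.ad k g e)) =
        finrank k (LinearMap.ker (LieAlgebra.ad k g x)) := by
  have hA := p.lieGr
  obtain ⟨u0, hu0, hu0x⟩ := p.exists_u0
  obtain ⟨c, hc⟩ := p.main_claim (φ := u0 * θ⁻¹) (c := ζ⁻¹) (mul_mem hu0.1 (inv_mem hθ)) hu0 hu0x
    (inv_ne_zero hζ) (by rw [LinearEquiv.mul_apply, inv_x hζ hx, map_smul, hu0x])
  have hroot : ∀ i, ∃ a : kˣ, a ^ m = c i := by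
    intro i
    obtain ⟨z, hz⟩ := IsAlgClosed.exists_pow_nat_eq (c i : k) (n := m) (by omega)
    have hz0 : z ≠ 0 := by
      rintro rfl
      rw [zero_pow (by omega)] at hz
      exact (c i).ne_zero hz.symm
    exact ⟨Units.mk0 z hz0, by ext; simpa using hz⟩
  choose a ha using hroot
  obtain ⟨α, hα⟩ := p.exists_D a
  have hτ : IsD ω c (α ^ m) := by
    refine ⟨pow_mem hα.1 m, fun μ v hv => ?_⟩
    have : ∀ n : ℕ, (α ^ n) v = ((chr a μ ^ n : kˣ) : k) • v := by
      intro n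
      induction n with
      | zero => simp
      | succ n ih =>
        rw [pow_succ', LinearEquiv.mul_apply, ih, map_smul, hα.2 μ v hv, smul_smul, pow_succ,
          Units.val_mul]
    rw [this m, ← chr_pow]
    congr 3
    ext i : 1
    exact ha i
  obtain ⟨t, ht, hteq⟩ := p.exists_t hθ hζ hx (isD_TT hα)
    (p.twist hθ hζ hx hθm hLF hα) hθm
  have hθt : θ⁻¹ * α ^ m = t⁻¹ * θ⁻¹ * t := by
    have h1 : α ^ m ∈ TT k ω := isD_TT hτ
    have h2 : θ * t * θ⁻¹ = (α ^ m)⁻¹ * t := eq_inv_mul_of_mul_eq hteq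
    have h3 := p.TT_comm (inv_mem h1) ht
    rw [h3] at h2
    have h4 : θ⁻¹ * α ^ m = t⁻¹ * (t * θ⁻¹ * α ^ m) := by group
    have h5 : t * θ⁻¹ = θ⁻¹ * (t * (α ^ m)⁻¹) := by rw [← h2]; group
    rw [h4, h5]; group
  let q := u0 * t⁻¹
  have hq : q ∈ Au k g := mul_mem hu0.1 (inv_mem ht.1)
  let ψ := q * θ⁻¹ * q⁻¹
  have hψe : ψ = u0 * θ⁻¹ * (α ^ m * u0⁻¹) := by
    have : u0 * θ⁻¹ * (α ^ m * u0⁻¹) = u0 * (θ⁻¹ * α ^ m) * u0⁻¹ := by group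
    rw [this, hθt]
    simp only [ψ, q]; group
  have htx : t x = x := ht.2 x p.x_mem
  have htix : t⁻¹ x = x := (inv_mem ht).2 x p.x_mem
  have hqx : q x = x + ∑ i, E i := by
    simp only [q, LinearEquiv.mul_apply]; rw [htix, hu0x]
  obtain ⟨v, hv, hve⟩ := p.step6 (ψ := ψ) (mul_mem (mul_mem hq (inv_mem hθ)) (inv_mem hq)) hm
    (by
      have : ψ ^ m = q * θ⁻¹ ^ m * q⁻¹ := conj_pow
      rw [this, inv_pow, hθm]; group) hζ
    (by
      rw [← hqx]
      simp only [ψ, LinearEquiv.mul_apply]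
      rw [inv_app, inv_x hζ hx, map_smul])
    (by
      intro w hw
      rw [hψe]
      exact hc _ hτ w hw)
  have hqv : q⁻¹ * v ∈ Au k g := mul_mem (inv_mem hq) hv
  refine ⟨(q⁻¹ * v) (∑ i, E i), ?_, Au.nilp hqv (hA.nilp (mem_up le_rfl p.e_mem)), ?_⟩
  · have h1 : θ⁻¹ (q⁻¹ (v (∑ i, E i))) = ζ⁻¹ • q⁻¹ (v (∑ i, E i)) := by
      rw [← map_smul, ← hve]
      simp only [ψ, LinearEquiv.mul_apply]
      rw [inv_app]
    rw [LinearEquiv.mul_apply]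
    have h2 := congrArg θ h1
    rw [app_inv, map_smul] at h2
    nth_rewrite 2 [h2]
    rw [smul_smul, mul_inv_cancel₀ hζ, one_smul]
  · rw [Au_ker hqv, p.finrank_ker_e]

end PF
end PNR
end PNR

section PNR
set_option linter.unusedSectionVars false
variable {k : Type*} [Field k] [IsAlgClosed k] [CharZero k]
variable {g : Type*} [LieRing g] [LieAlgebra k g] [FiniteDimensional k g]

namespace PNR

open LieAlgebra.IsKilling in
theorem exists_PF [LieAlgebra.IsKilling k g] {H : LieSubalgebra k g} [H.IsCartanSubalgebra]
    (b : (LieAlgebra.IsKilling.rootSystem H).Base) [DecidableEq b.support] {x : g} (hH : ∀ v, v ∈ H ↔ ⁅x, v⁆ = 0) :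
    ∃ (ω E : b.support → g) (F : g), PF k x ω E F := by
  let P := LieAlgebra.IsKilling.rootSystem H
  let w : b.support → H := fun i => (Module.evalEquiv k H).symm (b.toWeightBasis.coord i)
  have hw : ∀ (i : b.support) (f : Module.Dual k H), f (w i) = b.toWeightBasis.repr f i :=
    fun i f => Module.apply_evalEquiv_symm_apply k H f _
  have hrw : ∀ i j : b.support, P.root j (w i) = if j = i then 1 else 0 := by
    intro i j
    rw [hw, RootPairing.Base.toWeightBasis_repr_root, Finsupp.single_apply]
  have hspan : ∀ h : H, h = ∑ i : b.support, P.root i h • w i := by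
    intro h
    rw [← sub_eq_zero, ← Module.forall_dual_apply_eq_zero_iff k]
    intro f
    have hf := congrArg (fun q : Module.Dual k H => q h) (b.toWeightBasis.sum_repr f)
    simp only [LinearMap.sum_apply, LinearMap.smul_apply, RootPairing.Base.toWeightBasis_apply] at hf
    rw [map_sub, map_sum, ← hf, sub_eq_zero]
    refine Finset.sum_congr rfl fun i _ => ?_
    rw [map_smul, hw, smul_eq_mul, smul_eq_mul, mul_comm]
  let ω : b.support → g := fun i => (w i : g)
  let φ : (b.support → ℤ) → Module.Dual k H := fun μ => ∑ i, (μ i : k) • P.root i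
  have hφw : ∀ μ i, φ μ (w i) = (μ i : k) := by
    intro μ i
    simp only [φ, LinearMap.sum_apply, LinearMap.smul_apply, hrw, smul_eq_mul, mul_ite, mul_one,
      mul_zero, Finset.sum_ite_eq', Finset.mem_univ, if_true]
  have hwt : ∀ μ v, v ∈ wt k ω μ ↔ v ∈ rootSpace H (φ μ) := by
    intro μ v
    rw [mem_wt]
    constructor
    · intro hv
      refine LieModule.weightSpace_le_genWeightSpace g _ ?_
      rw [LieModule.mem_weightSpace]
      intro h
      have h1 : (h : g) = ∑ i : b.support, P.root i h • ω i := by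
        have := congrArg (fun q : H => (q : g)) (hspan h)
        simpa [ω] using this
      change ⁅(h : g), v⁆ = _
      rw [h1, sum_lie]
      simp only [φ, LinearMap.sum_apply, LinearMap.smul_apply, Finset.sum_smul, smul_lie, hv,
        smul_smul, smul_eq_mul, mul_comm]
    · intro hv i
      have := LieAlgebra.IsKilling.lie_eq_smul_of_mem_rootSpace hv (w i)
      rw [hφw] at this
      exact this
  have hwt0 : ∀ v, v ∈ wt k ω 0 ↔ v ∈ H := by
    intro v
    have : φ 0 = 0 := by simp [φ]
    rw [hwt, this]
    have h2 := LieAlgebra.rootSpace_zero_eq k g H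
    change v ∈ rootSpace H 0 ↔ _
    rw [h2]; simp
  have hroot : ∀ α : H.root, ∃ μ : b.support → ℤ, (0 ≤ μ ∨ μ ≤ 0) ∧ P.root α = φ μ := by
    intro α
    obtain ⟨f, -, hf, e⟩ := b.exists_root_eq_sum_int α
    refine ⟨fun i => f i, ?_, ?_⟩
    · rcases hf with hf | hf
      · left; intro i; exact hf.le i
      · right; intro i; exact hf.le i
    · rw [e, ← Finset.sum_coe_sort]
      refine Finset.sum_congr rfl fun i _ => ?_
      exact (Int.cast_smul_eq_zsmul k _ _).symm
  have hφinj : ∀ μ ν, φ μ = φ ν → μ = ν := by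
    intro μ ν h
    ext i
    have := congrArg (fun q : Module.Dual k H => q (w i)) h
    simp only [hφw] at this
    exact_mod_cast this
  have hne : ∀ μ, μ ≠ 0 → wt k ω μ ≠ ⊥ → ∃ α : H.root, P.root α = φ μ := by
    intro μ h0 hb
    have hb' : rootSpace H (φ μ) ≠ ⊥ := by
      intro hb'
      apply hb
      rw [eq_bot_iff]
      intro v hv
      rw [hwt, hb'] at hv
      simpa using hv
    let χ : LieModule.Weight k H g := ⟨φ μ, hb'⟩
    have hχ : χ.IsNonZero := by
      intro hz
      apply h0
      apply hφinj
      ext h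
      have := congrFun hz h
      simpa [χ, φ] using this
    refine ⟨⟨χ, by simpa using hχ⟩, ?_⟩
    ext h
    rfl
  have htriple : ∀ i : b.support, ∃ e f : g, e ≠ 0 ∧ ⁅e, f⁆ = (P.coroot i : H) ∧
      e ∈ rootSpace H (P.root i) ∧ f ∈ rootSpace H (-(P.root i) : Module.Dual k H) := by
    intro i
    have hi := LieSubalgebra.isNonZero_coe_root (i : H.root)
    obtain ⟨h, e, f, t, he, hf⟩ := exists_isSl2Triple_of_weight_isNonZero hi
    refine ⟨e, f, t.e_ne_zero, ?_, he, hf⟩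
    rw [t.lie_e_f, t.h_eq_coroot hi he hf]
    rfl
  choose e f he0 hef he hf using htriple
  have hdisj : ∀ i j : b.support, i ≠ j → ⁅e i, f j⁆ = 0 := by
    intro i j hij
    have h1 := LieAlgebra.lie_mem_genWeightSpace_of_mem_genWeightSpace (he i) (hf j)
    by_contra hn
    have hb' : rootSpace H (P.root i + -P.root j : Module.Dual k H) ≠ ⊥ := by
      intro hb
      apply hn
      have h2 : ⁅e i, f j⁆ ∈ rootSpace H (P.root i + -P.root j : Module.Dual k H) := h1
      rw [hb] at h2
      simpa using h2
    let χ : LieModule.Weight k H g := ⟨(P.root i + -P.root j : Module.Dual k H), hb'⟩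
    have hχ : χ.IsNonZero := by
      intro hz
      have h3 := congrFun hz (w i)
      have h4 : (P.root i + -P.root j : Module.Dual k H) (w i) = 0 := h3
      rw [LinearMap.add_apply, LinearMap.neg_apply, hrw, hrw, if_pos rfl, if_neg hij.symm] at h4
      simp at h4
    apply b.sub_notMem_range_root i.2 j.2
    refine ⟨⟨χ, by simpa using hχ⟩, ?_⟩
    ext h
    change (P.root i + -P.root j : Module.Dual k H) h = _
    rw [← sub_eq_add_neg]
  let c : b.support → k := fun j => b.toCoweightBasis.repr ((2 : k) • ∑ i, w i) j
  have hc : ∑ j, c j • (P.coroot j : H) = (2 : k) • ∑ i, w i := by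
    have := b.toCoweightBasis.sum_repr ((2 : k) • ∑ i, w i)
    simpa only [RootPairing.Base.toCoweightBasis_apply] using this
  refine ⟨ω, e, ∑ j, c j • f j, ?_⟩
  constructor
  · intro i j
    have : ⁅w i, w j⁆ = 0 := trivial_lie_zero H H _ _
    exact congrArg (fun q : H => (q : g)) this
  · rw [eq_top_iff]
    have h1 := LieModule.iSup_genWeightSpace_eq_top' k H g
    have h2 := congrArg LieSubmodule.toSubmodule h1
    rw [LieSubmodule.iSup_toSubmodule, LieSubmodule.top_toSubmodule] at h2
    rw [← h2]
    refine iSup_le fun χ => ?_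
    by_cases hχ : χ.IsZero
    · refine le_trans ?_ (le_iSup _ (0 : b.support → ℤ))
      intro v hv
      rw [hwt0]
      have hv' : v ∈ rootSpace H (χ : H → k) := hv
      have hχ' : (χ : H → k) = 0 := hχ
      rw [hχ', LieAlgebra.rootSpace_zero_eq k g H] at hv'
      simpa using hv'
    · obtain ⟨μ, -, hμ⟩ := hroot ⟨χ, by simpa using hχ⟩
      refine le_trans ?_ (le_iSup _ μ)
      intro v hv
      rw [hwt, ← hμ]
      exact hv
  · intro μ hμ
    by_cases h0 : μ = 0
    · left; rw [h0]
    · obtain ⟨α, hα⟩ := hne μ h0 hμ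
      obtain ⟨ν, hν, hν'⟩ := hroot α
      rw [hφinj μ ν (hα.symm.trans hν')]
      exact hν
  · intro v
    rw [hwt0, hH]
  · intro v hv
    rw [hwt0] at hv
    have h1 := congrArg (fun q : H => (q : g)) (hspan ⟨v, hv⟩)
    have h2 : v = ∑ i : b.support, P.root i ⟨v, hv⟩ • ω i := by simpa [ω] using h1
    rw [h2]
    exact Submodule.sum_mem _ fun i _ => Submodule.smul_mem _ _ (Submodule.subset_span ⟨i, rfl⟩)
  · intro μ h0
    by_cases hb : wt k ω μ = ⊥
    · rw [hb]; simp
    · obtain ⟨α, hα⟩ := hne μ h0 hb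
      have h1 : wt k ω μ = (rootSpace H (α : LieModule.Weight k H g)).toSubmodule := by
        ext v
        rw [hwt, ← hα]
        rfl
      rw [h1]
      exact (finrank_rootSpace_eq_one _ (LieSubalgebra.isNonZero_coe_root α)).le
  · intro i
    rw [hwt]
    have : φ (Pi.single i 1) = P.root i := by
      simp [φ, Pi.single_apply]
    rw [this]
    exact he i
  · exact he0
  · have h1 : ∀ j, ⁅∑ i, ω i, f j⁆ = - f j := by
      intro j
      have h2 := LieAlgebra.IsKilling.lie_eq_smul_of_mem_rootSpace (hf j) (∑ i, w i)
      have h3 : (-(P.root j) : Module.Dual k H) (∑ i, w i) = -1 := by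
        simp [hrw]
      rw [h3] at h2
      have h4 : ((∑ i, w i : H) : g) = ∑ i, ω i := by simp [ω]
      rw [← h4]
      simpa using h2
    rw [lie_sum]
    simp only [lie_smul, h1, smul_neg, Finset.sum_neg_distrib]
  · have h4 : ((∑ i, w i : H) : g) = ∑ i, ω i := by simp [ω]
    have h5 := congrArg (fun q : H => (q : g)) hc
    have h6 : ∑ j, c j • ((P.coroot j : H) : g) = (2 : k) • ∑ i, ω i := by
      rw [← h4]; simpa using h5
    rw [← h6, lie_sum]
    refine Finset.sum_congr rfl fun j _ => ?_
    rw [lie_smul, sum_lie, Finset.sum_eq_single j, hef]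
    · intro i _ hij
      exact hdisj i j hij
    · simp

end PNR
end PNR

section PNR
set_option linter.unusedSectionVars false
variable {k : Type*} [Field k] [IsAlgClosed k] [CharZero k]
variable {g : Type*} [LieRing g] [LieAlgebra k g] [FiniteDimensional k g]

namespace PNR

lemma finite_not_regular {x y : g} (hx : LieAlgebra.IsRegular k x) :
    {s : k | ¬ LieAlgebra.IsRegular k (x + s • y)}.Finite := by
  classical
  let b := Module.finBasis k g
  obtain ⟨P, hP⟩ : ∃ P : MvPolynomial (Fin (finrank k g)) k, ∀ z : g,
      LieAlgebra.IsRegular k z ↔ MvPolynomial.eval (b.repr z) P ≠ 0 :=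
    ⟨_, fun z => LieAlgebra.isRegular_iff_coeff_polyCharpoly_rank_ne_zero k b z⟩
  let Q : Polynomial k := MvPolynomial.aeval
    (fun i => Polynomial.C (b.repr x i) + Polynomial.X * Polynomial.C (b.repr y i)) P
  have hQ : ∀ s, Q.eval s = MvPolynomial.eval (b.repr (x + s • y)) P := by
    intro s
    have h1 : Polynomial.aeval s Q = MvPolynomial.aeval (b.repr (x + s • y)) P := by
      have h2 := MvPolynomial.comp_aeval_apply
        (fun i => Polynomial.C (b.repr x i) + Polynomial.X * Polynomial.C (b.repr y i))
        (Polynomial.aeval s) P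
      rw [show Polynomial.aeval s Q = _ from h2]
      have h3 : (fun i => (Polynomial.aeval s)
          (Polynomial.C (b.repr x i) + Polynomial.X * Polynomial.C (b.repr y i))) =
          (b.repr (x + s • y) : Fin (finrank k g) → k) := by
        funext i
        simp
        exact mul_comm _ _
      rw [h3]
    rw [Polynomial.coe_aeval_eq_eval, MvPolynomial.aeval_eq_eval] at h1
    exact h1
  have hQ0 : Q ≠ 0 := by
    intro h
    have h1 := hQ 0
    rw [h, zero_smul, add_zero] at h1
    rw [hP] at hx
    exact hx (by rw [← h1]; simp)
  refine (Polynomial.finite_setOfPred_isRoot hQ0).subset ?_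
  intro s hs
  rw [Set.mem_ofPred_eq, hP, not_not] at hs
  exact (hQ s).trans hs

lemma finite_not_inj {V : Submodule k g} {x y : g} (hy : ∀ v ∈ V, ⁅y, v⁆ = 0 → v = 0) :
    {s : k | ¬ ∀ v ∈ V, ⁅x + s • y, v⁆ = 0 → v = 0}.Finite := by
  let A : g → (V →ₗ[k] g) := fun z => (LieAlgebra.ad k g z : g →ₗ[k] g) ∘ₗ V.subtype
  have hA : LinearMap.ker (A y) = ⊥ := by
    rw [LinearMap.ker_eq_bot']
    rintro ⟨v, hv⟩ h
    exact Subtype.ext (hy v hv h)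
  obtain ⟨C, hC⟩ := LinearMap.exists_leftInverse_of_injective _ hA
  let M : Module.End k V := C ∘ₗ A x
  have hfin : {r : k | M.HasEigenvalue r}.Finite := Module.End.finite_hasEigenvalue M
  refine (hfin.preimage (f := fun s : k => -s) (neg_injective.injOn)).subset ?_
  intro s hs
  simp only [Set.mem_ofPred_eq, not_forall] at hs
  obtain ⟨v, hv, h0, hne⟩ := hs
  refine Module.End.hasEigenvalue_of_hasEigenvector (x := ⟨v, hv⟩) ⟨?_, ?_⟩
  · rw [Module.End.mem_eigenspace_iff]
    have h1 : A x ⟨v, hv⟩ = -(s • A y ⟨v, hv⟩) := by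
      rw [eq_neg_iff_add_eq_zero, ← h0, add_lie, smul_lie]
      rfl
    have h2 : C (A y ⟨v, hv⟩) = ⟨v, hv⟩ := LinearMap.congr_fun hC _
    change C (A x ⟨v, hv⟩) = _
    rw [h1, map_neg, map_smul, h2, neg_smul]
  · intro h
    exact hne (congrArg Subtype.val h)

lemma engel_eq_ker {x : g} (hx : (LieAlgebra.ad k g x).IsSemisimple) (v : g) :
    v ∈ LieSubalgebra.engel k x ↔ ⁅x, v⁆ = 0 := by
  have h := hx.isFinitelySemisimple.maxGenEigenspace_eq_eigenspace 0
  rw [LieSubalgebra.mem_engel_iff]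
  constructor
  · rintro ⟨n, hn⟩
    have h1 : v ∈ (LieAlgebra.ad k g x).maxGenEigenspace 0 := by
      rw [Module.End.mem_maxGenEigenspace]
      exact ⟨n, by simpa using hn⟩
    rw [h, Module.End.mem_eigenspace_iff] at h1
    simpa using h1
  · intro h
    exact ⟨1, by simpa using h⟩

lemma isRegular_of_ss {x : g} (hx : (LieAlgebra.ad k g x).IsSemisimple)
    (hr : finrank k (LinearMap.ker (LieAlgebra.ad k g x)) = LieAlgebra.rank k g) :
    LieAlgebra.IsRegular k x := by
  rw [LieAlgebra.isRegular_iff_finrank_engel_eq_rank, ← hr]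
  have : (LieSubalgebra.engel k x).toSubmodule = LinearMap.ker (LieAlgebra.ad k g x) := by
    ext v
    rw [LieSubalgebra.mem_toSubmodule, engel_eq_ker hx]; simp
  rw [← this]; rfl

lemma cartan_of_isRegular {x : g} (hx : LieAlgebra.IsRegular k x) :
    (LieSubalgebra.engel k x).IsCartanSubalgebra := by
  have : Infinite k := IsAlgClosed.instInfinite
  have h : finrank k g ≤ Cardinal.mk k :=
    Cardinal.natCast_le_aleph0.trans <| Cardinal.infinite_iff.mp ‹Infinite k›
  refine ⟨?_, LieSubalgebra.normalizer_engel _ _⟩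
  apply LieSubalgebra.isNilpotent_of_forall_le_engel
  intro y hy
  set Ex : {LieSubalgebra.engel k z | z ∈ LieSubalgebra.engel k x} :=
    ⟨LieSubalgebra.engel k x, x, LieSubalgebra.self_mem_engel _ _, rfl⟩
  suffices IsBot Ex from @this ⟨LieSubalgebra.engel k y, y, hy, rfl⟩
  apply LieAlgebra.engel_isBot_of_isMin h (LieSubalgebra.engel k x) Ex le_rfl
  rintro ⟨_, y, hy, rfl⟩ hyx
  suffices finrank k (LieSubalgebra.engel k x) ≤ finrank k (LieSubalgebra.engel k y) by
    suffices LieSubalgebra.engel k y = LieSubalgebra.engel k x from this.ge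
    apply LieSubalgebra.toSubmodule_injective
    exact Submodule.eq_of_le_of_finrank_le hyx this
  rw [(LieAlgebra.isRegular_iff_finrank_engel_eq_rank k x).mp hx]
  apply LieAlgebra.rank_le_finrank_engel

end PNR
end PNR

theorem nRegular_of_sRegular_locallyFree
    (m : ℕ) (hm : 1 ≤ m) (ζ : k) (hζ : IsPrimitiveRoot ζ m)
    (θ : g ≃ₗ[k] g) (hθb : ∀ x y : g, θ ⁅x, y⁆ = ⁅θ x, θ y⁆) (hθm : θ ^ m = 1)
    (hS : ∃ x ∈ gradePiece k g ζ θ (1 : ZMod m), (LieAlgebra.ad k g x).IsSemisimple ∧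
      Module.finrank k (zc k g x) = LieAlgebra.rank k g)
    (hLF : ∃ y ∈ gradePiece k g ζ θ (1 : ZMod m),
      zc k g y ⊓ gradePiece k g ζ θ (0 : ZMod m) = ⊥) :
    ∃ e ∈ gradePiece k g ζ θ (1 : ZMod m), IsNilpotent (LieAlgebra.ad k g e) ∧
      Module.finrank k (zc k g e) = LieAlgebra.rank k g := by
  obtain ⟨x₁, hx₁, hss, hrk⟩ := hS
  obtain ⟨y₁, hy₁, hy⟩ := hLF
  have hIK : LieAlgebra.IsKilling k g := LieAlgebra.HasTrivialRadical.instIsKilling k g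
  have hInf : Infinite k := IsAlgClosed.instInfinite
  have hζ1 : ζ ^ (1 : ZMod m).val = ζ := by
    rcases Nat.lt_or_ge 1 m with h | h
    · have : Fact (1 < m) := ⟨h⟩
      rw [ZMod.val_one, pow_one]
    · have hm1 : m = 1 := le_antisymm h hm
      subst hm1
      have : ζ = 1 := by simpa using hζ.pow_eq_one
      rw [this, one_pow]
  have h1 : ∀ v, v ∈ gradePiece k g ζ θ (1 : ZMod m) ↔ θ v = ζ • v := by
    intro v
    rw [gradePiece, Module.End.mem_eigenspace_iff, hζ1]
    rfl
  have h0 : ∀ v, v ∈ gradePiece k g ζ θ (0 : ZMod m) ↔ θ v = v := by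
    intro v
    rw [gradePiece, Module.End.mem_eigenspace_iff, ZMod.val_zero, pow_zero, one_smul]
    rfl
  have hy' : ∀ v ∈ gradePiece k g ζ θ (0 : ZMod m), ⁅y₁, v⁆ = 0 → v = 0 := by
    intro v hv h
    have : v ∈ zc k g y₁ ⊓ gradePiece k g ζ θ (0 : ZMod m) := ⟨h, hv⟩
    rw [hy] at this
    simpa using this
  obtain ⟨s, hs⟩ := ((PNR.finite_not_regular (y := y₁) (PNR.isRegular_of_ss hss hrk)).union
    (PNR.finite_not_inj (x := x₁) hy')).exists_notMem
  rw [Set.mem_union, not_or] at hs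
  have hreg : LieAlgebra.IsRegular k (x₁ + s • y₁) := not_not.mp hs.1
  have hinj : ∀ v ∈ gradePiece k g ζ θ (0 : ZMod m), ⁅x₁ + s • y₁, v⁆ = 0 → v = 0 :=
    not_not.mp hs.2
  have hx : θ (x₁ + s • y₁) = ζ • (x₁ + s • y₁) :=
    (h1 _).mp (add_mem hx₁ (Submodule.smul_mem _ _ hy₁))
  generalize x₁ + s • y₁ = x at hreg hinj hx
  have hC := PNR.cartan_of_isRegular hreg
  have hxs : (LieAlgebra.ad k g x).IsSemisimple :=
    LieAlgebra.IsKilling.isSemisimple_ad_of_mem_isCartanSubalgebra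
      (H := LieSubalgebra.engel k x) (LieSubalgebra.self_mem_engel k x)
  have hH := PNR.engel_eq_ker hxs
  obtain ⟨b⟩ := (LieAlgebra.IsKilling.rootSystem (LieSubalgebra.engel k x)).nonempty_base
  classical
  obtain ⟨ω, E, F, p⟩ := PNR.exists_PF b hH
  obtain ⟨e, he, hn, hf⟩ := p.final hm (θ := θ) (m := m) hθb (hζ.ne_zero (by omega)) hx hθm
    (fun v hv hv' => hinj v ((h0 v).mpr hv) hv')
  refine ⟨e, (h1 e).mpr he, hn, ?_⟩
  rw [zc, hf, ← (LieAlgebra.isRegular_iff_finrank_engel_eq_rank k x).mp hreg]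
  have : (LieSubalgebra.engel k x).toSubmodule = LinearMap.ker (LieAlgebra.ad k g x) := by
    ext v
    rw [LieSubalgebra.mem_toSubmodule, hH]; simp
  rw [← this]
  rfl
end

section
/- Let c be a Cartan subspace of g_1 and let t be a Cartan subalgebra of g with θ(t) = t and c ⊆ t. Then t ∩ g_1 = c. -/
open LieAlgebra Module

variable (k : Type*) [Field k] [IsAlgClosed k] [CharZero k]
variable (g : Type*) [LieRing g] [LieAlgebra k g] [FiniteDimensional k g]
  [LieAlgebra.IsSemisimple k g]

theorem cartanSubalgebra_inter_g1_eq
    (m : ℕ) (hm : 1 ≤ m) (ζ : k) (hζ : IsPrimitiveRoot ζ m)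
    (θ : g ≃ₗ[k] g) (hθb : ∀ x y : g, θ ⁅x, y⁆ = ⁅θ x, θ y⁆) (hθm : θ ^ m = 1)
    (c : Submodule k g) (hc : IsCartanSubspace k g m ζ θ c)
    (t : LieSubalgebra k g) (ht : t.IsCartanSubalgebra)
    (hstab : Submodule.map (θ : g →ₗ[k] g) t.toSubmodule = t.toSubmodule)
    (hct : c ≤ t.toSubmodule) :
    t.toSubmodule ⊓ gradePiece k g ζ θ (1 : ZMod m) = c := by
  obtain ⟨h1, h2, h3, h4⟩ := hc
  haveI := ht
  haveI : LieAlgebra.IsKilling k g := inferInstance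
  refine (h4 _ inf_le_right ?_ ?_ (le_inf hct h1)).symm
  · intro x hx y hy
    have h := LieModule.IsTrivial.trivial (⟨x, hx.1⟩ : t) (⟨y, hy.1⟩ : t)
    exact congrArg Subtype.val h
  · intro x hx
    exact LieAlgebra.IsKilling.isSemisimple_ad_of_mem_isCartanSubalgebra (H := t) hx.1
end
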